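/- arXiv:1503.04411 — 3 statements merged into one kernel-verified Lean document; each statement's English description precedes it below -/
import Mathlib

section
/- There exists a universal constant C₀ > 0 such that for every real ε with 1/2 < ε < 3/2 and every λ ∈ ℝ, the principal value integral p.v. ∫_ℝ e^{i·sgn(t)·|t|^ε} e^{−iλt} dt/t exists and satisfies | p.v. ∫_ℝ e^{i·sgn(t)·|t|^ε} e^{−iλt} dt/t | ≤ C₀. -/
open MeasureTheory Filter Set
open scoped ENNReal Topology

def Trip (f f1 f2 : ℝ → ℝ) : Prop :=
  (∀ x, HasDerivAt f (f1 x) x) ∧ (∀ x, HasDerivAt f1 (f2 x) x) ∧ Continuous f2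

lemma Trip.cf {f f1 f2 : ℝ → ℝ} (h : Trip f f1 f2) : Continuous f :=
  continuous_iff_continuousAt.2 fun x => (h.1 x).continuousAt

lemma Trip.cf1 {f f1 f2 : ℝ → ℝ} (h : Trip f f1 f2) : Continuous f1 :=
  continuous_iff_continuousAt.2 fun x => (h.2.1 x).continuousAt

lemma Trip.mono {f f1 f2 : ℝ → ℝ} (h : Trip f f1 f2) {y z : ℝ}
    (h2 : ∀ x ∈ Icc y z, 0 ≤ f2 x) : MonotoneOn f1 (Icc y z) := by
  apply monotoneOn_of_deriv_nonneg (convex_Icc y z) h.cf1.continuousOn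
  · exact fun x _ => (h.2.1 x).differentiableAt.differentiableWithinAt
  · intro x hx
    rw [(h.2.1 x).deriv]
    exact h2 x (interior_subset hx)

lemma lemB {f f1 f2 : ℝ → ℝ} (h : Trip f f1 f2) {y z : ℝ} (hyz : y ≤ z)
    (h2 : ∀ x ∈ Icc y z, 0 ≤ f2 x) (hy : 0 < f1 y) :
    |∫ x in y..z, Real.sin (f x)| ≤ 2 / f1 y := by
  have hm := h.mono h2
  have hpos : ∀ x ∈ Icc y z, 0 < f1 x := fun x hx =>
    lt_of_lt_of_le hy (hm (left_mem_Icc.2 hyz) hx hx.1)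
  have hu : uIcc y z = Icc y z := uIcc_of_le hyz
  -- derivative of -cos f / f1
  have hd : ∀ x ∈ uIcc y z, HasDerivAt (fun x => -Real.cos (f x) / f1 x)
      (Real.sin (f x) + Real.cos (f x) * (f2 x / f1 x ^ 2)) x := by
    intro x hx
    rw [hu] at hx
    have hp := hpos x hx
    have := ((h.1 x).cos.neg).div (h.2.1 x) hp.ne'
    refine this.congr_deriv ?_
    simp only [Pi.neg_apply]
    field_simp
    ring
  have hd' : ∀ x ∈ uIcc y z, HasDerivAt (fun x => -(f1 x)⁻¹) (f2 x / f1 x ^ 2) x := by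
    intro x hx
    rw [hu] at hx
    have hp := hpos x hx
    have := ((h.2.1 x).inv hp.ne').neg
    refine this.congr_deriv ?_
    ring
  have c2 : ContinuousOn (fun x => f2 x / f1 x ^ 2) (uIcc y z) := by
    apply h.2.2.continuousOn.div (h.cf1.pow 2).continuousOn
    intro x hx
    rw [hu] at hx
    exact pow_ne_zero _ (hpos x hx).ne'
  have i2 := c2.intervalIntegrable (μ := volume)
  have cc : Continuous (fun x => Real.cos (f x)) := Real.continuous_cos.comp h.cf
  have cs : Continuous (fun x => Real.sin (f x)) := Real.continuous_sin.comp h.cf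
  have i3 : IntervalIntegrable (fun x => Real.cos (f x) * (f2 x / f1 x ^ 2)) volume y z :=
    (cc.continuousOn.mul c2).intervalIntegrable (μ := volume)
  have i1 := cs.intervalIntegrable (μ := volume) y z
  have e1 := intervalIntegral.integral_eq_sub_of_hasDerivAt hd (i1.add i3)
  rw [intervalIntegral.integral_add i1 i3] at e1
  have e2 := intervalIntegral.integral_eq_sub_of_hasDerivAt hd' i2
  have b : |∫ x in y..z, Real.cos (f x) * (f2 x / f1 x ^ 2)| ≤ ∫ x in y..z, f2 x / f1 x ^ 2 := by
    rw [← Real.norm_eq_abs]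
    apply intervalIntegral.norm_integral_le_of_norm_le hyz _ i2
    refine Eventually.of_forall fun x hx => ?_
    have hx' : x ∈ Icc y z := ⟨hx.1.le, hx.2⟩
    have : 0 ≤ f2 x / f1 x ^ 2 := div_nonneg (h2 x hx') (sq_nonneg _)
    rw [norm_mul, Real.norm_eq_abs, Real.norm_eq_abs, abs_of_nonneg this]
    exact mul_le_of_le_one_left this (Real.abs_cos_le_one _)
  rw [e2] at b
  have hz := hpos z (right_mem_Icc.2 hyz)
  have b1 : |-Real.cos (f z) / f1 z| ≤ (f1 z)⁻¹ := by
    rw [abs_div, abs_neg, abs_of_pos hz, div_eq_mul_inv]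
    exact mul_le_of_le_one_left (inv_pos.2 hz).le (Real.abs_cos_le_one _)
  have b2 : |-Real.cos (f y) / f1 y| ≤ (f1 y)⁻¹ := by
    rw [abs_div, abs_neg, abs_of_pos hy, div_eq_mul_inv]
    exact mul_le_of_le_one_left (inv_pos.2 hy).le (Real.abs_cos_le_one _)
  rw [div_eq_mul_inv]
  rw [abs_le] at *
  constructor <;> linarith [b.1, b.2, b1.1, b1.2, b2.1, b2.2]

lemma lemA0 {f f1 f2 : ℝ → ℝ} (h : Trip f f1 f2) {y z K : ℝ} (hyz : y ≤ z) (hK : 0 ≤ K)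
    (hf : ∀ x ∈ Icc y z, 0 ≤ f x) (hf1 : ∀ x ∈ Icc y z, f x ≤ K * f1 x) (hz : f1 z ≤ 1) :
    |∫ x in y..z, Real.sin (f x)| ≤ K ^ 2 := by
  have i1 := (h.cf1.const_mul K).intervalIntegrable (μ := volume) y z
  have e := intervalIntegral.integral_eq_sub_of_hasDerivAt (fun x _ => h.1 x)
    (h.cf1.intervalIntegrable (μ := volume) y z)
  have b : ‖∫ x in y..z, Real.sin (f x)‖ ≤ ∫ x in y..z, K * f1 x := by
    apply intervalIntegral.norm_integral_le_of_norm_le hyz _ i1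
    refine Eventually.of_forall fun x hx => ?_
    have hx' : x ∈ Icc y z := ⟨hx.1.le, hx.2⟩
    calc |Real.sin (f x)| ≤ |f x| := Real.abs_sin_le_abs
      _ = f x := abs_of_nonneg (hf x hx')
      _ ≤ _ := hf1 x hx'
  rw [intervalIntegral.integral_const_mul, e, Real.norm_eq_abs] at b
  have h1 := hf y (left_mem_Icc.2 hyz)
  have h2 := hf1 z (right_mem_Icc.2 hyz)
  have h3 : f z - f y ≤ K := by nlinarith
  nlinarith

lemma lemA {f f1 f2 : ℝ → ℝ} (h : Trip f f1 f2) {y z K : ℝ} (hyz : y ≤ z) (hK : 0 ≤ K)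
    (hf : ∀ x ∈ Icc y z, 0 ≤ f x) (hf1 : ∀ x ∈ Icc y z, f x ≤ K * f1 x)
    (h2 : ∀ x ∈ Icc y z, 0 ≤ f2 x) :
    |∫ x in y..z, Real.sin (f x)| ≤ K ^ 2 + 2 := by
  have hK2 := sq_nonneg K
  rcases le_or_gt 1 (f1 y) with h1 | h1
  · have := lemB h hyz h2 (by linarith)
    have h3 : 2 / f1 y ≤ 2 := div_le_self (by norm_num) h1
    linarith
  rcases le_or_gt (f1 z) 1 with h3 | h3
  · have := lemA0 h hyz hK hf hf1 h3
    linarith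
  obtain ⟨w, hw, hw1⟩ := intermediate_value_Icc hyz h.cf1.continuousOn ⟨h1.le, h3.le⟩
  have cs : Continuous (fun x => Real.sin (f x)) := Real.continuous_sin.comp h.cf
  rw [← intervalIntegral.integral_add_adjacent_intervals
    (cs.intervalIntegrable (μ := volume) y w) (cs.intervalIntegrable (μ := volume) w z)]
  have s1 : Icc y w ⊆ Icc y z := Icc_subset_Icc_right hw.2
  have s2 : Icc w z ⊆ Icc y z := Icc_subset_Icc_left hw.1
  have a := lemA0 h hw.1 hK (fun x hx => hf x (s1 hx)) (fun x hx => hf1 x (s1 hx)) hw1.le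
  have b := lemB h hw.2 (fun x hx => h2 x (s2 hx)) (by rw [hw1]; norm_num)
  rw [hw1] at b
  have := abs_add_le (∫ x in y..w, Real.sin (f x)) (∫ x in w..z, Real.sin (f x))
  linarith

def Bd (g : ℝ → ℝ) (S : Set ℝ) (C : ℝ) : Prop :=
  ∀ y z, y ∈ S → z ∈ S → y ≤ z → |∫ x in y..z, g x| ≤ C

lemma Bd.comb {g : ℝ → ℝ} (hg : Continuous g) {S : Set ℝ} {m C1 C2 : ℝ} (hm : m ∈ S)
    (h1 : Bd g (S ∩ Iic m) C1) (h2 : Bd g (S ∩ Ici m) C2) : Bd g S (C1 + C2) := by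
  intro y z hy hz hyz
  have p1 : 0 ≤ C1 := (abs_nonneg _).trans (h1 m m ⟨hm, le_refl m⟩ ⟨hm, le_refl m⟩ le_rfl)
  have p2 : 0 ≤ C2 := (abs_nonneg _).trans (h2 m m ⟨hm, le_refl m⟩ ⟨hm, le_refl m⟩ le_rfl)
  rcases le_total z m with h | h
  · linarith [h1 y z ⟨hy, hyz.trans h⟩ ⟨hz, h⟩ hyz]
  rcases le_total m y with h' | h'
  · linarith [h2 y z ⟨hy, h'⟩ ⟨hz, h⟩ hyz]
  rw [← intervalIntegral.integral_add_adjacent_intervals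
    (hg.intervalIntegrable (μ := volume) y m) (hg.intervalIntegrable (μ := volume) m z)]
  have := abs_add_le (∫ x in y..m, g x) (∫ x in m..z, g x)
  linarith [h1 y m ⟨hy, h'⟩ ⟨hm, le_refl m⟩ h', h2 m z ⟨hm, le_refl m⟩ ⟨hz, h⟩ h]

lemma Bd.neg {f : ℝ → ℝ} {S : Set ℝ} {C : ℝ} (h : Bd (fun x => Real.sin (-f x)) S C) :
    Bd (fun x => Real.sin (f x)) S C := by
  intro y z hy hz hyz
  have := h y z hy hz hyz
  simpa [Real.sin_neg] using this

lemma tail {f f1 f2 : ℝ → ℝ} (h : Trip f f1 f2) {c : ℝ} (h2 : ∀ x, c ≤ x → 0 ≤ f2 x)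
    (ht : Tendsto f1 atTop atTop) :
    ∃ L, Tendsto (fun b => ∫ x in (0 : ℝ)..b, Real.sin (f x)) atTop (𝓝 L) := by
  apply cauchySeq_tendsto_of_complete
  rw [Metric.cauchySeq_iff']
  intro e he
  obtain ⟨N, hN1, hN2⟩ := ((ht.eventually_gt_atTop (2 / e)).and (eventually_ge_atTop c)).exists
  refine ⟨N, fun n hn => ?_⟩
  have cs : Continuous (fun x => Real.sin (f x)) := Real.continuous_sin.comp h.cf
  rw [Real.dist_eq, intervalIntegral.integral_interval_sub_left
    (cs.intervalIntegrable (μ := volume) _ _) (cs.intervalIntegrable (μ := volume) _ _)]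
  have p : 0 < 2 / e := by positivity
  refine (lemB h hn (fun x hx => h2 x (hN2.trans hx.1)) (p.trans hN1)).trans_lt ?_
  rw [div_lt_iff₀ (p.trans hN1)]
  rw [div_lt_iff₀ he] at hN1
  linarith

lemma tail_neg {f : ℝ → ℝ}
    (h : ∃ L, Tendsto (fun b => ∫ x in (0 : ℝ)..b, Real.sin (-f x)) atTop (𝓝 L)) :
    ∃ L, Tendsto (fun b => ∫ x in (0 : ℝ)..b, Real.sin (f x)) atTop (𝓝 L) := by
  obtain ⟨L, hL⟩ := h
  refine ⟨-L, ?_⟩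
  have := hL.neg
  simpa [Real.sin_neg] using this

lemma tripF (p q e : ℝ) : Trip (fun x => p * Real.exp (e * x) + q * Real.exp x)
    (fun x => p * (e * Real.exp (e * x)) + q * Real.exp x)
    (fun x => p * (e ^ 2 * Real.exp (e * x)) + q * Real.exp x) := by
  have h1 : ∀ x, HasDerivAt (fun x => Real.exp (e * x)) (e * Real.exp (e * x)) x := by
    intro x
    have := ((hasDerivAt_id x).const_mul e).exp
    simpa [mul_comm] using this
  refine ⟨fun x => ?_, fun x => ?_, by fun_prop⟩
  · exact ((h1 x).const_mul p).add ((Real.hasDerivAt_exp x).const_mul q)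
  · refine ((((h1 x).const_mul e).const_mul p).add
      ((Real.hasDerivAt_exp x).const_mul q)).congr_deriv ?_
    ring

lemma psiA {p q e K : ℝ} {S : Set ℝ} (hS : S.OrdConnected) (hK : 0 ≤ K)
    (H : ∀ x ∈ S, 0 ≤ p * Real.exp (e * x) + q * Real.exp x ∧
      p * Real.exp (e * x) + q * Real.exp x ≤ K * (p * (e * Real.exp (e * x)) + q * Real.exp x) ∧
      0 ≤ p * (e ^ 2 * Real.exp (e * x)) + q * Real.exp x) :
    Bd (fun x => Real.sin (p * Real.exp (e * x) + q * Real.exp x)) S (K ^ 2 + 2) := by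
  intro y z hy hz hyz
  have s := hS.out hy hz
  exact lemA (tripF p q e) hyz hK (fun x hx => (H x (s hx)).1) (fun x hx => (H x (s hx)).2.1)
    (fun x hx => (H x (s hx)).2.2)

lemma tailF {p q e k a c : ℝ} (hk : 0 < k) (ha : 0 < a)
    (H1 : ∀ x, c ≤ x → k * Real.exp (a * x) ≤ p * (e * Real.exp (e * x)) + q * Real.exp x)
    (H2 : ∀ x, c ≤ x → 0 ≤ p * (e ^ 2 * Real.exp (e * x)) + q * Real.exp x) :
    ∃ L, Tendsto (fun b => ∫ x in (0 : ℝ)..b,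
      Real.sin (p * Real.exp (e * x) + q * Real.exp x)) atTop (𝓝 L) := by
  refine tail (tripF p q e) H2 ?_
  have h0 : Tendsto (fun x : ℝ => k * Real.exp (a * x)) atTop atTop :=
    (Real.tendsto_exp_atTop.comp (tendsto_id.const_mul_atTop ha)).const_mul_atTop hk
  refine tendsto_atTop_mono' _ ?_ h0
  filter_upwards [eventually_ge_atTop c] with x hx using H1 x hx

def Core (g : ℝ → ℝ) : Prop :=
  (∃ L, Tendsto (fun b => ∫ x in (0 : ℝ)..b, Real.sin (g x)) atTop (𝓝 L)) ∧
    Bd (fun x => Real.sin (g x)) univ 18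

lemma Bd.weak {g : ℝ → ℝ} {S T : Set ℝ} {C D : ℝ} (h : Bd g S C) (hT : T ⊆ S) (hC : C ≤ D) :
    Bd g T D := fun y z hy hz hyz => (h y z (hT hy) (hT hz) hyz).trans hC

lemma triv {f : ℝ → ℝ} {a b : ℝ} (h : b ≤ a + 4) :
    Bd (fun x => Real.sin (f x)) (Icc a b) 4 := by
  intro y z hy hz hyz
  have := intervalIntegral.norm_integral_le_of_norm_le_const (a := y) (b := z) (C := 1)
    (f := fun x => Real.sin (f x)) (fun x _ => Real.abs_sin_le_one _)
  rw [Real.norm_eq_abs, abs_of_nonneg (by linarith : 0 ≤ z - y)] at this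
  linarith [hy.1, hz.2]

lemma three {f : ℝ → ℝ} (hf : Continuous f) {m c : ℝ} (hmc : m ≤ c) (h4 : c ≤ m + 4)
    (h1 : Bd (fun x => Real.sin (f x)) (Iic m) 11) (h3 : Bd (fun x => Real.sin (f x)) (Ici c) 3) :
    Bd (fun x => Real.sin (f x)) univ 18 := by
  have cs : Continuous (fun x => Real.sin (f x)) := Real.continuous_sin.comp hf
  have a : Bd (fun x => Real.sin (f x)) (Iic c) (11 + 4) :=
    Bd.comb cs (m := m) hmc (h1.weak inter_subset_right le_rfl)
      ((triv h4).weak (fun x hx => ⟨hx.2, hx.1⟩) le_rfl)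
  exact (Bd.comb cs (m := c) (mem_univ _) (a.weak inter_subset_right le_rfl)
    (h3.weak inter_subset_right le_rfl)).weak le_rfl (by norm_num)

lemma core {e : ℝ} (he : 1 / 2 < e) (he' : e < 3 / 2) (l : ℝ) :
    Core (fun x => 1 * Real.exp (e * x) + (-l) * Real.exp x) := by
  have e0 : ∀ x, - (1 * Real.exp (e * x) + (-l) * Real.exp x) =
    (-1) * Real.exp (e * x) + l * Real.exp x := fun x => by ring
  have negT : (∃ L, Tendsto (fun b => ∫ x in (0 : ℝ)..b,
      Real.sin ((-1) * Real.exp (e * x) + l * Real.exp x)) atTop (𝓝 L)) →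
      (∃ L, Tendsto (fun b => ∫ x in (0 : ℝ)..b,
      Real.sin (1 * Real.exp (e * x) + (-l) * Real.exp x)) atTop (𝓝 L)) := by
    intro h
    simp only [← e0] at h
    exact tail_neg h
  have negB : ∀ S C, Bd (fun x => Real.sin ((-1) * Real.exp (e * x) + l * Real.exp x)) S C →
      Bd (fun x => Real.sin (1 * Real.exp (e * x) + (-l) * Real.exp x)) S C := by
    intro S C h
    simp only [← e0] at h
    exact h.neg
  rcases le_or_gt l 0 with hl | hl
  · have key : ∀ x : ℝ, 0 < Real.exp (e * x) ∧ 0 ≤ -l * Real.exp x := fun x =>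
      ⟨Real.exp_pos _, mul_nonneg (by linarith) (Real.exp_pos _).le⟩
    refine ⟨tailF (k := e) (a := e) (c := 0) (by linarith) (by linarith) ?_ ?_, ?_⟩
    · intro x _
      linarith [key x]
    · intro x _
      obtain ⟨h1, h2⟩ := key x
      positivity
    · refine (psiA (K := 2) ordConnected_univ (by norm_num) ?_).weak le_rfl (by norm_num)
      intro x _
      obtain ⟨h1, h2⟩ := key x
      refine ⟨by positivity, ?_, by positivity⟩
      nlinarith
  have hcont : ∀ p q : ℝ, Continuous (fun x => p * Real.exp (e * x) + q * Real.exp x) := by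
    intro p q
    fun_prop
  have ex : ∀ x, Real.exp (e * x) = Real.exp ((e - 1) * x) * Real.exp x := fun x => by
    rw [← Real.exp_add]; ring_nf
  rcases lt_trichotomy e 1 with h1 | h1 | h1
  · -- e < 1
    set c := Real.log l / (e - 1) with hc
    set m := c - 2 * Real.log e / (e - 1) with hm
    have hlog : Real.log e < 0 := Real.log_neg (by linarith) h1
    have hlog2 : 1 - e⁻¹ ≤ Real.log e := Real.one_sub_inv_le_log_of_pos (by linarith)
    have hmc : m ≤ c := by
      have : 0 ≤ 2 * Real.log e / (e - 1) :=
        div_nonneg_of_nonpos (by linarith) (by linarith)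
      linarith
    have h4 : c ≤ m + 4 := by
      have : 2 * Real.log e / (e - 1) ≤ 4 := by
        rw [div_le_iff_of_neg (by linarith)]
        have : 1 - e⁻¹ ≥ -2 * (1 - e) := by
          have : e⁻¹ * e = 1 := inv_mul_cancel₀ (by linarith)
          have h2 : e⁻¹ ≤ 2 := by
            rw [inv_le_comm₀ (by linarith) (by norm_num)]; linarith
          nlinarith
        linarith
      linarith
    have hne : e - 1 ≠ 0 := by linarith
    have hcm : (e - 1) * c = Real.log l := by rw [hc]; field_simp
    have hx1 : ∀ x, c ≤ x → Real.exp (e * x) ≤ l * Real.exp x := by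
      intro x hx
      rw [ex]
      gcongr
      rw [← Real.le_log_iff_exp_le hl]
      nlinarith
    have hx2 : ∀ x, x ≤ m → l * Real.exp x ≤ e ^ 2 * Real.exp (e * x) := by
      intro x hx
      rw [ex, ← mul_assoc]
      gcongr
      rw [← Real.log_le_log_iff hl (by positivity), Real.log_mul (by positivity) (by positivity),
        Real.log_exp, Real.log_pow]
      have : (e - 1) * m = Real.log l - 2 * Real.log e := by
        rw [hm, mul_sub, hcm]
        field_simp
      push_cast
      nlinarith
    have e2 : e ^ 2 ≤ 1 := by nlinarith
    constructor
    · apply negT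
      refine tailF (k := l * (1 - e)) (a := 1) (c := c) (mul_pos hl (by linarith)) (by norm_num) ?_ ?_
      · intro x hx
        rw [one_mul]
        nlinarith [hx1 x hx, Real.exp_pos x]
      · intro x hx
        nlinarith [hx1 x hx, Real.exp_pos (e * x)]
    · apply three (hcont _ _) hmc h4
      · refine (psiA (K := 3) ordConnected_Iic (by norm_num) ?_).weak le_rfl (by norm_num)
        intro x hx
        have a := hx2 x hx
        have b := Real.exp_pos (e * x)
        refine ⟨by nlinarith, ?_, by nlinarith⟩
        nlinarith [mul_nonneg (mul_nonneg (by linarith : 0 ≤ 2 * e - 1) (by linarith : 0 ≤ 1 - e)) b.le]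
      · apply negB
        refine (psiA (K := 1) ordConnected_Ici (by norm_num) ?_).weak le_rfl (by norm_num)
        intro x hx
        have a := hx1 x hx
        have b := Real.exp_pos (e * x)
        refine ⟨by nlinarith, by nlinarith, by nlinarith⟩
  · -- e = 1
    subst h1
    have e0 : ∀ x : ℝ, Real.exp (1 * x) = Real.exp x := fun x => by rw [one_mul]
    rcases lt_trichotomy l 1 with h | h | h
    · refine ⟨tailF (k := 1 - l) (a := 1) (c := 0) (by linarith) (by linarith) ?_ ?_, ?_⟩
      · intro x _
        rw [e0]; linarith
      · intro x _
        rw [e0]; nlinarith [Real.exp_pos x]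
      · refine (psiA (K := 1) ordConnected_univ (by norm_num) ?_).weak le_rfl (by norm_num)
        intro x _
        rw [e0]
        have := Real.exp_pos x
        refine ⟨by nlinarith, by nlinarith, by nlinarith⟩
    · subst h
      refine ⟨⟨0, ?_⟩, ?_⟩
      · simp
      · intro y z _ _ _
        simp
    · refine ⟨negT (tailF (k := l - 1) (a := 1) (c := 0) (by linarith) (by linarith) ?_ ?_),
        negB _ _ ?_⟩
      · intro x _
        rw [e0]; linarith
      · intro x _
        rw [e0]; nlinarith [Real.exp_pos x]
      · refine (psiA (K := 1) ordConnected_univ (by norm_num) ?_).weak le_rfl (by norm_num)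
        intro x _
        rw [e0]
        have := Real.exp_pos x
        refine ⟨by nlinarith, by nlinarith, by nlinarith⟩
  · -- e > 1
    set c := Real.log l / (e - 1) with hc
    set m := c - 2 * Real.log e / (e - 1) with hm
    have hlog : 0 < Real.log e := Real.log_pos h1
    have hlog2 : Real.log e ≤ e - 1 := Real.log_le_sub_one_of_pos (by linarith)
    have hmc : m ≤ c := by
      have : 0 ≤ 2 * Real.log e / (e - 1) := div_nonneg (by linarith) (by linarith)
      linarith
    have h4 : c ≤ m + 4 := by
      have : 2 * Real.log e / (e - 1) ≤ 4 := by
        rw [div_le_iff₀ (by linarith)]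
        linarith
      linarith
    have hne : e - 1 ≠ 0 := by linarith
    have hcm : (e - 1) * c = Real.log l := by rw [hc]; field_simp
    have hx1 : ∀ x, c ≤ x → l * Real.exp x ≤ Real.exp (e * x) := by
      intro x hx
      rw [ex]
      gcongr
      rw [← Real.log_le_iff_le_exp hl]
      nlinarith
    have hx2 : ∀ x, x ≤ m → e ^ 2 * Real.exp (e * x) ≤ l * Real.exp x := by
      intro x hx
      rw [ex, ← mul_assoc]
      gcongr
      rw [← Real.log_le_log_iff (by positivity) hl, Real.log_mul (by positivity) (by positivity),
        Real.log_exp, Real.log_pow]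
      have : (e - 1) * m = Real.log l - 2 * Real.log e := by
        rw [hm, mul_sub, hcm]
        field_simp
      push_cast
      nlinarith
    have e2 : 1 ≤ e ^ 2 := by nlinarith
    constructor
    · refine tailF (k := l * (e - 1)) (a := 1) (c := c) (mul_pos hl (by linarith)) (by norm_num) ?_ ?_
      · intro x hx
        rw [one_mul]
        nlinarith [hx1 x hx, Real.exp_pos x]
      · intro x hx
        nlinarith [hx1 x hx, Real.exp_pos (e * x)]
    · apply three (hcont _ _) hmc h4
      · apply negB
        refine (psiA (K := 3) ordConnected_Iic (by norm_num) ?_).weak le_rfl (by norm_num)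
        intro x hx
        have a := hx2 x hx
        have b := Real.exp_pos (e * x)
        refine ⟨by nlinarith, ?_, by nlinarith⟩
        nlinarith [mul_nonneg (mul_nonneg (by linarith : 0 ≤ 2 * e - 1) (by linarith : 0 ≤ e - 1)) b.le]
      · refine (psiA (K := 1) ordConnected_Ici (by norm_num) ?_).weak le_rfl (by norm_num)
        intro x hx
        have a := hx1 x hx
        have b := Real.exp_pos (e * x)
        refine ⟨by nlinarith, by nlinarith, by nlinarith⟩

lemma headF {e l : ℝ} (he : 1 / 2 < e) :
    ∃ L, Tendsto (fun b => ∫ x in b..(0 : ℝ),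
      Real.sin (1 * Real.exp (e * x) + (-l) * Real.exp x)) atBot (𝓝 L) := by
  refine ⟨_, intervalIntegral_tendsto_integral_Iic 0 ?_ tendsto_id⟩
  have h1 : IntegrableOn (fun x : ℝ => Real.exp (e * x)) (Iic 0) :=
    integrableOn_exp_mul_Iic (by linarith) 0
  have h2 : IntegrableOn (fun x : ℝ => Real.exp x) (Iic 0) := integrableOn_exp_Iic 0
  have h3 := h1.add (h2.const_mul |l|)
  refine Integrable.mono' h3 (by fun_prop) (Eventually.of_forall fun x => ?_)
  refine (Real.abs_sin_le_abs).trans ((abs_add_le _ _).trans ?_)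
  simp [abs_mul]

lemma conv (e l d R : ℝ) (hd : 0 < d) (hR : d ≤ R) :
    (∫ t in {t : ℝ | d ≤ |t| ∧ |t| ≤ R},
          Complex.exp (Complex.I * ((Real.sign t * |t| ^ e : ℝ) : ℂ)) *
            Complex.exp (-(Complex.I * (l : ℂ) * (t : ℂ))) / (t : ℂ)) =
    2 * Complex.I * ((∫ x in (Real.log d)..(Real.log R),
      Real.sin (1 * Real.exp (e * x) + (-l) * Real.exp x) : ℝ) : ℂ) := by
  set F : ℝ → ℂ := fun t => Complex.exp (Complex.I * ((Real.sign t * |t| ^ e : ℝ) : ℂ)) *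
            Complex.exp (-(Complex.I * (l : ℂ) * (t : ℂ))) / (t : ℂ) with hF
  have hS : {t : ℝ | d ≤ |t| ∧ |t| ≤ R} = Icc (-R) (-d) ∪ Icc d R := by
    ext t
    simp only [mem_ofPred_eq, mem_union, mem_Icc, le_abs, abs_le]
    constructor
    · rintro ⟨h | h, h1, h2⟩
      · right; exact ⟨h, h2⟩
      · left; constructor <;> linarith
    · rintro (⟨h1, h2⟩ | ⟨h1, h2⟩)
      · refine ⟨Or.inr ?_, ?_, ?_⟩ <;> linarith
      · refine ⟨Or.inl ?_, ?_, ?_⟩ <;> linarith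
  have hpow : ∀ t : ℝ, t ≠ 0 → ContinuousAt (fun t : ℝ => |t| ^ e) t := fun t ht =>
    (continuous_abs.continuousAt).rpow_const (Or.inl (by simpa using ht))
  have hc : ∀ s : Set ℝ, (∀ t ∈ s, t ≠ 0) → ContinuousOn (fun t : ℝ => |t| ^ e) s :=
    fun s hs t ht => (hpow t (hs t ht)).continuousWithinAt
  have cG : ∀ (σ : ℝ) (s : Set ℝ), (∀ t ∈ s, t ≠ 0) →
      ContinuousOn (fun t : ℝ => Complex.exp (Complex.I * ((σ * |t| ^ e : ℝ) : ℂ)) *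
            Complex.exp (-(Complex.I * (l : ℂ) * (t : ℂ))) / (t : ℂ)) s := by
    intro σ s hs
    have h := hc _ hs
    refine ContinuousOn.div (by fun_prop) (by fun_prop) ?_
    intro t ht
    exact_mod_cast hs t ht
  have cR : ContinuousOn F (Icc d R) := by
    refine (cG 1 (Icc d R) fun t ht => (hd.trans_le ht.1).ne').congr fun t ht => ?_
    simp only [hF]
    rw [Real.sign_of_pos (hd.trans_le ht.1)]
  have cL : ContinuousOn F (Icc (-R) (-d)) := by
    have hn : ∀ t ∈ Icc (-R) (-d), t < 0 := fun t ht => by linarith [ht.2]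
    refine (cG (-1) _ fun t ht => (hn t ht).ne).congr fun t ht => ?_
    simp only [hF]
    rw [Real.sign_of_neg (hn t ht)]
  rw [hS, setIntegral_union _ measurableSet_Icc cL.integrableOn_Icc cR.integrableOn_Icc,
    integral_Icc_eq_integral_Ioc, integral_Icc_eq_integral_Ioc,
    ← intervalIntegral.integral_of_le hR, ← intervalIntegral.integral_of_le (by linarith),
    ← intervalIntegral.integral_comp_neg (a := d) (b := R) F]
  · have i1 : IntervalIntegrable F volume d R :=
      ContinuousOn.intervalIntegrable (by rwa [uIcc_of_le hR])
    have i2 : IntervalIntegrable (fun t => F (-t)) volume d R := by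
      apply ContinuousOn.intervalIntegrable
      rw [uIcc_of_le hR]
      exact cL.comp continuous_neg.continuousOn fun t ht => ⟨by linarith [ht.2], by linarith [ht.1]⟩
    rw [← intervalIntegral.integral_add i2 i1]
    have hsub := intervalIntegral.integral_comp_mul_deriv'
      (a := Real.log d) (b := Real.log R) (f := Real.exp) (f' := Real.exp)
      (g := fun t => Real.sin (t ^ e - l * t) / t)
      (fun x _ => Real.hasDerivAt_exp x) Real.continuous_exp.continuousOn (by
        have hpos : ∀ t ∈ Real.exp '' uIcc (Real.log d) (Real.log R), t ≠ 0 := by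
          rintro _ ⟨x, _, rfl⟩
          exact (Real.exp_pos x).ne'
        have hq : ContinuousOn (fun t : ℝ => t ^ e) (Real.exp '' uIcc (Real.log d) (Real.log R)) :=
          continuousOn_id.rpow_const fun t ht => Or.inl (hpos t ht)
        exact ContinuousOn.div (by fun_prop) continuousOn_id hpos)
    rw [Real.exp_log hd, Real.exp_log (hd.trans_le hR)] at hsub
    have e1 : (∫ x in (Real.log d)..(Real.log R),
        Real.sin (1 * Real.exp (e * x) + (-l) * Real.exp x)) =
        ∫ t in d..R, Real.sin (t ^ e - l * t) / t := by
      rw [← hsub]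
      refine intervalIntegral.integral_congr fun x _ => ?_
      simp only [Function.comp]
      rw [div_mul_cancel₀ _ (Real.exp_pos x).ne', ← Real.exp_mul, mul_comm x e]
      ring_nf
    rw [e1, ← intervalIntegral.integral_ofReal, ← intervalIntegral.integral_const_mul]
    refine intervalIntegral.integral_congr fun t ht => ?_
    rw [uIcc_of_le hR] at ht
    have ht0 := hd.trans_le ht.1
    have htc : (t : ℂ) ≠ 0 := by exact_mod_cast ht0.ne'
    simp only [hF]
    rw [Real.sign_of_pos ht0, Real.sign_of_neg (by linarith), abs_neg, abs_of_pos ht0,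
      ← Complex.exp_add, ← Complex.exp_add]
    generalize t ^ e = w
    push_cast
    rw [Complex.sin]
    have a1 : Complex.I * (-1 * (w : ℂ)) + -(Complex.I * l * -t) =
      -((w : ℂ) - l * t) * Complex.I := by ring
    have a2 : Complex.I * (1 * (w : ℂ)) + -(Complex.I * l * t) =
      ((w : ℂ) - l * t) * Complex.I := by ring
    rw [a1, a2]
    field_simp
    rw [Complex.I_sq]
    ring
  · rw [Set.disjoint_left]
    intro t h1 h2
    linarith [h1.2, h2.1]

theorem stmt_5 :
    ∃ C₀ : ℝ, 0 < C₀ ∧ ∀ ε : ℝ, 1 / 2 < ε → ε < 3 / 2 → ∀ l : ℝ, ∃ I : ℂ,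
      Filter.Tendsto
        (fun p : ℝ × ℝ => ∫ t in {t : ℝ | p.1 ≤ |t| ∧ |t| ≤ p.2},
          Complex.exp (Complex.I * ((Real.sign t * |t| ^ ε : ℝ) : ℂ)) *
            Complex.exp (-(Complex.I * (l : ℂ) * (t : ℂ))) / (t : ℂ))
        ((nhdsWithin (0 : ℝ) (Set.Ioi 0)) ×ˢ Filter.atTop) (nhds I) ∧ ‖I‖ ≤ C₀ := by
  refine ⟨36, by norm_num, fun e he he' l => ?_⟩
  obtain ⟨⟨L, hL⟩, hB⟩ := core he he' l
  obtain ⟨M, hM⟩ := headF (l := l) he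
  have cs : Continuous (fun x => Real.sin (1 * Real.exp (e * x) + (-l) * Real.exp x)) := by
    fun_prop
  have hev : ∀ᶠ p : ℝ × ℝ in (nhdsWithin (0 : ℝ) (Set.Ioi 0)) ×ˢ atTop, 0 < p.1 ∧ p.1 ≤ p.2 := by
    have h1 : ∀ᶠ d : ℝ in nhdsWithin (0 : ℝ) (Set.Ioi 0), 0 < d ∧ d < 1 := by
      filter_upwards [Ioo_mem_nhdsGT (zero_lt_one' ℝ)] with d hd using hd
    filter_upwards [h1.prod_mk (eventually_ge_atTop (1 : ℝ))] with p hp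
    exact ⟨hp.1.1, hp.1.2.le.trans hp.2⟩
  have hT : Tendsto
        (fun p : ℝ × ℝ => ∫ t in {t : ℝ | p.1 ≤ |t| ∧ |t| ≤ p.2},
          Complex.exp (Complex.I * ((Real.sign t * |t| ^ e : ℝ) : ℂ)) *
            Complex.exp (-(Complex.I * (l : ℂ) * (t : ℂ))) / (t : ℂ))
        ((nhdsWithin (0 : ℝ) (Set.Ioi 0)) ×ˢ Filter.atTop)
        (nhds (2 * Complex.I * ((M + L : ℝ) : ℂ))) := by
    have t1 := (hM.comp Real.tendsto_log_nhdsGT_zero).comp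
      (tendsto_fst (f := nhdsWithin (0 : ℝ) (Set.Ioi 0)) (g := (atTop : Filter ℝ)))
    have t2 := (hL.comp Real.tendsto_log_atTop).comp
      (tendsto_snd (f := nhdsWithin (0 : ℝ) (Set.Ioi 0)) (g := (atTop : Filter ℝ)))
    have t3 := ((Complex.continuous_ofReal.tendsto _).comp (t1.add t2)).const_mul (2 * Complex.I)
    refine t3.congr' ?_
    filter_upwards [hev] with p hp
    rw [conv e l p.1 p.2 hp.1 hp.2, ← intervalIntegral.integral_add_adjacent_intervals
      (cs.intervalIntegrable (μ := volume) (Real.log p.1) 0)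
      (cs.intervalIntegrable (μ := volume) 0 (Real.log p.2))]
    rfl
  refine ⟨_, hT, le_of_tendsto hT.norm ?_⟩
  filter_upwards [hev] with p hp
  rw [conv e l p.1 p.2 hp.1 hp.2]
  have := hB (Real.log p.1) (Real.log p.2) trivial trivial (Real.log_le_log hp.1 hp.2)
  rw [norm_mul, norm_mul, Complex.norm_I, Complex.norm_real, Complex.norm_ofNat, Real.norm_eq_abs]
  linarith
end

section
/- The operator T f(x) := p.v. ∫_ℝ e^{i|y|} f(x−y) dy/y is not bounded on L²(ℝ): there is no constant C > 0 such that ‖T f‖_{L²(ℝ)} ≤ C ‖f‖_{L²(ℝ)} holds for all Schwartz functions f : ℝ → ℂ. -/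
open MeasureTheory Filter Set
open scoped ENNReal Topology

noncomputable def GG (f : ℝ → ℂ) (x y : ℝ) : ℂ :=
  Complex.exp (Complex.I * (y : ℂ)) * (f (x - y) - f (x + y)) / (y : ℂ)

lemma GG_int (f : ℝ → ℂ) (hf : Continuous f) (K : NNReal) (hK : LipschitzWith K f) (B : ℝ)
    (hB : ∀ y, B ≤ |y| → f y = 0) (x : ℝ) : IntegrableOn (GG f x) (Ioi 0) := by
  have hm : Measurable (GG f x) := by
    unfold GG
    have := hf.measurable
    fun_prop
  have h1 : IntegrableOn (GG f x) (Ioc 0 (|x| + |B|)) := by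
    refine Measure.integrableOn_of_bounded (M := 2 * K) (by simp) hm.aestronglyMeasurable ?_
    refine (ae_restrict_iff' measurableSet_Ioc).2 (Eventually.of_forall fun y hy => ?_)
    have hy0 : 0 < y := hy.1
    have h2 := hK.dist_le_mul (x - y) (x + y)
    rw [dist_eq_norm, Real.dist_eq] at h2
    have h3 : |x - y - (x + y)| = 2 * y := by
      rw [show x - y - (x + y) = -(2 * y) by ring, abs_neg, abs_of_pos (by linarith)]
    rw [h3] at h2
    unfold GG
    rw [norm_div, norm_mul, mul_comm Complex.I, Complex.norm_exp_ofReal_mul_I, Complex.norm_real,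
      Real.norm_of_nonneg hy0.le, div_le_iff₀ hy0]
    linarith
  refine h1.of_forall_diff_eq_zero measurableSet_Ioi ?_
  rintro y ⟨hy, hy'⟩
  simp only [mem_Ioi, mem_Ioc, not_and, not_le] at hy hy'
  have := hy' hy
  have a1 := abs_le.1 (le_refl |x|)
  have a3 := le_abs_self B
  have h1 : f (x - y) = 0 := hB _ (by rw [abs_sub_comm]; refine le_trans ?_ (le_abs_self _); linarith)
  have h2 : f (x + y) = 0 := hB _ (by refine le_trans ?_ (le_abs_self _); linarith)
  simp [GG, h1, h2]

lemma pv_split (f : ℝ → ℂ) (hf : Continuous f) (x δ R : ℝ) (hδ : 0 < δ) (hR : δ ≤ R) :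
    ∫ y in {y : ℝ | δ ≤ |y| ∧ |y| ≤ R},
            Complex.exp (Complex.I * ((|y| : ℝ) : ℂ)) * f (x - y) / (y : ℂ)
      = ∫ y in Icc δ R, GG f x y := by
  set F : ℝ → ℂ := fun y => Complex.exp (Complex.I * ((|y| : ℝ) : ℂ)) * f (x - y) / (y : ℂ) with hF
  have hs : {y : ℝ | δ ≤ |y| ∧ |y| ≤ R} = Icc δ R ∪ Icc (-R) (-δ) := by
    ext y
    simp only [mem_setOf_eq, mem_union, mem_Icc]
    rcases abs_cases y with ⟨h, h'⟩ | ⟨h, h'⟩ <;> rw [h]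
    · constructor
      · intro h; exact Or.inl h
      · rintro (h | h)
        · exact h
        · linarith
    · constructor
      · intro h; right; constructor <;> linarith
      · rintro (h | h)
        · linarith
        · constructor <;> linarith
  have hd : Disjoint (Icc δ R) (Icc (-R) (-δ)) := by
    rw [Set.disjoint_left]
    rintro y hy hy'
    linarith [hy.1, hy'.2]
  have hc : ∀ s : Set ℝ, (∀ y ∈ s, y ≠ 0) → ContinuousOn F s := by
    intro s hs
    apply ContinuousOn.div
    · apply Continuous.continuousOn; fun_prop
    · apply Continuous.continuousOn; fun_prop
    · intro y hy; exact_mod_cast hs y hy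
  have c1 : ContinuousOn F (Icc δ R) := hc _ fun y hy => by linarith [hy.1] |> fun (h : 0 < y) => h.ne'
  have c2 : ContinuousOn F (Icc (-R) (-δ)) := hc _ fun y hy => by
    have : y < 0 := by linarith [hy.2]
    exact this.ne
  rw [hs, setIntegral_union hd measurableSet_Icc (c1.integrableOn_Icc) (c2.integrableOn_Icc)]
  have e2 : ∫ y in Icc (-R) (-δ), F y = ∫ y in Icc δ R, F (-y) := by
    rw [integral_Icc_eq_integral_Ioc, integral_Icc_eq_integral_Ioc,
      ← intervalIntegral.integral_of_le (by linarith), ← intervalIntegral.integral_of_le hR,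
      intervalIntegral.integral_comp_neg]
  have c3 : ContinuousOn (fun y => F (-y)) (Icc δ R) := by
    apply c2.comp (by fun_prop)
    intro y hy
    exact ⟨by linarith [hy.2], by linarith [hy.1]⟩
  rw [e2, ← integral_add c1.integrableOn_Icc c3.integrableOn_Icc]
  refine setIntegral_congr_fun measurableSet_Icc fun y hy => ?_
  have hy0 : 0 < y := by linarith [hy.1]
  simp only [hF, GG, abs_neg, abs_of_pos hy0, sub_neg_eq_add, Complex.ofReal_neg]
  rw [div_neg]
  ring

lemma pv_tendsto (f : ℝ → ℂ) (hf : Continuous f) (x : ℝ) (hi : IntegrableOn (GG f x) (Ioi 0)) :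
    Filter.Tendsto
          (fun p : ℝ × ℝ => ∫ y in {y : ℝ | p.1 ≤ |y| ∧ |y| ≤ p.2},
            Complex.exp (Complex.I * ((|y| : ℝ) : ℂ)) * f (x - y) / (y : ℂ))
          ((nhdsWithin (0 : ℝ) (Set.Ioi 0)) ×ˢ Filter.atTop) (nhds (∫ y in Ioi 0, GG f x y)) := by
  have t1 : Tendsto (fun p : ℝ × ℝ => p.1) ((nhdsWithin (0 : ℝ) (Set.Ioi 0)) ×ˢ Filter.atTop)
    (nhdsWithin (0 : ℝ) (Set.Ioi 0)) := tendsto_fst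
  have t2 : Tendsto (fun p : ℝ × ℝ => p.2) ((nhdsWithin (0 : ℝ) (Set.Ioi 0)) ×ˢ Filter.atTop)
    (atTop : Filter ℝ) := tendsto_snd
  have hpos : ∀ᶠ p : ℝ × ℝ in ((nhdsWithin (0 : ℝ) (Set.Ioi 0)) ×ˢ Filter.atTop), 0 < p.1 :=
    t1.eventually self_mem_nhdsWithin
  have hlt : ∀ y : ℝ, 0 < y → ∀ᶠ p : ℝ × ℝ in ((nhdsWithin (0 : ℝ) (Set.Ioi 0)) ×ˢ Filter.atTop), p.1 < y :=
    fun y hy => t1.eventually (mem_nhdsWithin_of_mem_nhds (Iio_mem_nhds hy))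
  have key : Tendsto (fun p : ℝ × ℝ => ∫ y in Ioi 0, (Icc p.1 p.2).indicator (GG f x) y)
      ((nhdsWithin (0 : ℝ) (Set.Ioi 0)) ×ˢ Filter.atTop) (nhds (∫ y in Ioi 0, GG f x y)) := by
    refine tendsto_integral_filter_of_dominated_convergence (fun y => ‖GG f x y‖) ?_ ?_ hi.norm ?_
    · exact Eventually.of_forall fun p => hi.aestronglyMeasurable.indicator measurableSet_Icc
    · exact Eventually.of_forall fun p => Eventually.of_forall fun y => norm_indicator_le_norm_self _ _
    · refine (ae_restrict_iff' measurableSet_Ioi).2 (Eventually.of_forall fun y hy => ?_)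
      refine tendsto_const_nhds.congr' ?_
      filter_upwards [hlt y hy, t2.eventually (eventually_ge_atTop y)] with p h1 h2
      rw [indicator_of_mem]
      exact ⟨h1.le, h2⟩
  refine key.congr' ?_
  filter_upwards [hpos, hlt 1 one_pos, t2.eventually (eventually_ge_atTop 1)] with p h0 h1 h2
  rw [pv_split f hf x p.1 p.2 h0 (by linarith), setIntegral_indicator measurableSet_Icc]
  congr 2
  exact inter_eq_right.2 fun y hy => lt_of_lt_of_le h0 hy.1

noncomputable def eta (x : ℝ) : ℝ := Real.smoothTransition (Real.cos (2 * x) - 4 / 5)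

lemma eta_nonneg (x : ℝ) : 0 ≤ eta x := Real.smoothTransition.nonneg _
lemma eta_le_one (x : ℝ) : eta x ≤ 1 := Real.smoothTransition.le_one _
lemma eta_contDiff {n : ℕ∞} : ContDiff ℝ n eta := by
  unfold eta
  exact Real.smoothTransition.contDiff.comp (by fun_prop)
lemma eta_cont : Continuous eta := (eta_contDiff (n := 0)).continuous
lemma eta_per : Function.Periodic eta Real.pi := by
  intro x
  simp only [eta]
  rw [show 2 * (x + Real.pi) = 2 * x + 2 * Real.pi by ring, Real.cos_add_two_pi]
lemma eta_ne {x : ℝ} (h : eta x ≠ 0) : 4 / 5 < Real.cos (2 * x) := by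
  by_contra h'
  exact h (Real.smoothTransition.zero_of_nonpos (by linarith))

noncomputable def AA : ℝ := ∫ y in (0 : ℝ)..Real.pi, eta y

lemma AA_pos : 0 < AA := by
  refine intervalIntegral.integral_pos Real.pi_pos eta_cont.continuousOn (fun x _ => eta_nonneg x)
    ⟨0, ⟨le_rfl, Real.pi_pos.le⟩, ?_⟩
  apply Real.smoothTransition.pos_of_pos
  norm_num

lemma eta_int (a : ℝ) : ∫ y in a..(a + Real.pi), eta y = AA := by
  rw [eta_per.intervalIntegral_add_eq a 0, zero_add, AA]

lemma eta_int' (x a : ℝ) : ∫ y in a..(a + Real.pi), eta (x - y) = AA := by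
  rw [intervalIntegral.integral_comp_sub_left, ← eta_int (x - (a + Real.pi))]
  congr 1; ring

noncomputable def LL (M : ℕ) : ℝ := ∑ m ∈ Finset.range M, AA / (Real.pi * (m + 2))

lemma LL_tendsto : Tendsto LL atTop atTop := by
  have h := Real.tendsto_sum_range_one_div_nat_succ_atTop
  have h2 := h.const_mul_atTop (show 0 < AA / (2 * Real.pi) by have := AA_pos; positivity)
  refine tendsto_atTop_mono (fun M => ?_) h2
  rw [Finset.mul_sum, LL]
  refine Finset.sum_le_sum fun m _ => ?_
  rw [div_mul_div_comm, mul_one]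
  have := AA_pos
  apply div_le_div_of_nonneg_left this.le (by positivity)
  nlinarith [Real.pi_pos]

lemma eta_log (x : ℝ) (M : ℕ) :
    LL M ≤ ∫ y in Real.pi..(Real.pi * (M + 1)), eta (x - y) / y := by
  have hpi := Real.pi_pos
  have hc : ∀ a b : ℝ, 0 < a → 0 < b →
      IntervalIntegrable (fun y => eta (x - y) / y) volume a b := by
    intro a b ha hb
    apply ContinuousOn.intervalIntegrable
    have := eta_cont
    apply ContinuousOn.div (by fun_prop) (by fun_prop)
    intro y hy
    have : 0 < y := lt_of_lt_of_le (lt_min ha hb) hy.1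
    exact this.ne'
  have hs := intervalIntegral.sum_integral_adjacent_intervals (μ := volume)
    (f := fun y => eta (x - y) / y)
    (a := fun k : ℕ => Real.pi * (k + 1)) (n := M)
    (fun k _ => hc _ _ (by positivity) (by positivity))
  simp only [Nat.cast_zero, zero_add, mul_one] at hs
  rw [← hs, LL]
  refine Finset.sum_le_sum fun m _ => ?_
  have he : Real.pi * (((m + 1 : ℕ) : ℝ) + 1) = Real.pi * (m + 1) + Real.pi := by push_cast; ring
  rw [he]
  have : AA / (Real.pi * (m + 2)) =
      ∫ y in (Real.pi * (m + 1))..(Real.pi * (m + 1) + Real.pi),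
        eta (x - y) / (Real.pi * (m + 2)) := by
    rw [intervalIntegral.integral_div, eta_int']
  rw [this]
  have hec := eta_cont
  refine intervalIntegral.integral_mono_on (by linarith) ?_ (hc _ _ (by positivity) (by positivity)) ?_
  · apply Continuous.intervalIntegrable; fun_prop
  · intro y hy
    have hy0 : 0 < y := lt_of_lt_of_le (by positivity) hy.1
    apply div_le_div_of_nonneg_left (eta_nonneg _) hy0
    have := hy.2
    linarith

noncomputable def bmp (M : ℕ) : ContDiffBump (0 : ℝ) where
  rIn := Real.pi * (M + 1)
  rOut := 2 * (Real.pi * (M + 1))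
  rIn_pos := by have := Real.pi_pos; positivity
  rIn_lt_rOut := by
    have : 0 < Real.pi * ((M : ℝ) + 1) := by have := Real.pi_pos; positivity
    linarith

noncomputable def phi (M : ℕ) (x : ℝ) : ℝ := eta x * bmp M x

noncomputable def ff (M : ℕ) (x : ℝ) : ℂ := Complex.exp ((x : ℂ) * Complex.I) * (phi M x : ℂ)

lemma phi_nonneg (M : ℕ) (x : ℝ) : 0 ≤ phi M x := mul_nonneg (eta_nonneg x) (bmp M).nonneg
lemma phi_le_one (M : ℕ) (x : ℝ) : phi M x ≤ 1 :=
  mul_le_one₀ (eta_le_one x) (bmp M).nonneg (bmp M).le_one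

lemma phi_zero (M : ℕ) (y : ℝ) (h : 2 * (Real.pi * (M + 1)) ≤ |y|) : phi M y = 0 := by
  rw [phi, (bmp M).zero_of_le_dist, mul_zero]
  simpa [bmp] using h

lemma ff_contDiff (M : ℕ) {n : ℕ∞} : ContDiff ℝ n (ff M) := by
  have h1 : ContDiff ℝ n (phi M) := eta_contDiff.mul (bmp M).contDiff
  have h2 : ContDiff ℝ n (fun x => (phi M x : ℂ)) := Complex.ofRealCLM.contDiff.comp h1
  have h3 : ContDiff ℝ n (fun x : ℝ => (x : ℂ)) := Complex.ofRealCLM.contDiff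
  exact ((h3.mul contDiff_const).cexp).mul h2

lemma ff_supp (M : ℕ) : HasCompactSupport (ff M) := by
  refine HasCompactSupport.intro (K := Icc (-(2 * (Real.pi * (M + 1)))) (2 * (Real.pi * (M + 1))))
    isCompact_Icc fun x hx => ?_
  rw [ff, phi_zero, Complex.ofReal_zero, mul_zero]
  by_contra h
  push Not at h
  exact hx ⟨(abs_lt.1 h).1.le, (abs_lt.1 h).2.le⟩

lemma ff_norm (M : ℕ) (x : ℝ) : ‖ff M x‖ = phi M x := by
  rw [ff, norm_mul, Complex.norm_exp_ofReal_mul_I, one_mul, Complex.norm_real,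
    Real.norm_of_nonneg (phi_nonneg M x)]

lemma GG_re (M : ℕ) (x y : ℝ) :
    (Complex.exp (-((x : ℂ) * Complex.I)) * GG (ff M) x y).re
      = (phi M (x - y) - Real.cos (2 * y) * phi M (x + y)) / y := by
  have : Complex.exp (-((x : ℂ) * Complex.I)) * GG (ff M) x y
      = ((phi M (x - y) : ℂ) - Complex.exp (((2 * y : ℝ) : ℂ) * Complex.I) * (phi M (x + y) : ℂ)) / (y : ℂ) := by
    rw [GG, ff, ff, ← mul_div_assoc]
    congr 1
    rw [mul_sub, mul_sub, ← mul_assoc, ← mul_assoc, ← mul_assoc, ← mul_assoc, ← Complex.exp_add, ← Complex.exp_add,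
      ← Complex.exp_add]
    congr 1
    · convert one_mul _
      rw [← Complex.exp_zero]; congr 1; push_cast; ring
    · congr 2; push_cast; ring
  rw [this, Complex.div_ofReal_re, Complex.sub_re, Complex.ofReal_re, Complex.mul_re,
    Complex.exp_ofReal_mul_I_re]
  simp

lemma cos_neg_of (a b : ℝ) (ha : Real.cos a < -(4 / 5)) (hb : 4 / 5 < Real.cos b) :
    Real.cos (b - a) ≤ 0 := by
  rw [Real.cos_sub]
  nlinarith [Real.sin_sq_add_cos_sq a, Real.sin_sq_add_cos_sq b, sq_nonneg (Real.sin a - Real.sin b)]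

lemma g_lower (M : ℕ) (x : ℝ) (hx0 : 0 ≤ x) (hx1 : x ≤ Real.pi * M)
    (hx : eta (x + Real.pi / 2) ≠ 0) (hi : IntegrableOn (GG (ff M) x) (Ioi 0)) :
    LL M ≤ ‖∫ y in Ioi 0, GG (ff M) x y‖ := by
  have hpi := Real.pi_pos
  have hxc : Real.cos (2 * x) < -(4 / 5) := by
    have := eta_ne hx
    rw [show 2 * (x + Real.pi / 2) = 2 * x + Real.pi by ring, Real.cos_add_pi] at this
    linarith
  have hi2 : IntegrableOn (fun y => Complex.exp (-((x : ℂ) * Complex.I)) * GG (ff M) x y) (Ioi 0) :=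
    hi.const_mul _
  have hre : ∫ y in Ioi 0, (Complex.exp (-((x : ℂ) * Complex.I)) * GG (ff M) x y).re
      = (Complex.exp (-((x : ℂ) * Complex.I)) * ∫ y in Ioi 0, GG (ff M) x y).re := by
    rw [← integral_const_mul]
    exact integral_re hi2
  have hn : (Complex.exp (-((x : ℂ) * Complex.I)) * ∫ y in Ioi 0, GG (ff M) x y).re
      ≤ ‖∫ y in Ioi 0, GG (ff M) x y‖ := by
    refine (Complex.re_le_norm _).trans ?_
    rw [norm_mul, ← neg_mul, ← Complex.ofReal_neg, Complex.norm_exp_ofReal_mul_I, one_mul]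
  refine le_trans ?_ hn
  rw [← hre]
  have hi3 : IntegrableOn (fun y => (Complex.exp (-((x : ℂ) * Complex.I)) * GG (ff M) x y).re) (Ioi 0) :=
    hi2.re
  have hpt : ∀ y : ℝ, 0 < y → phi M (x - y) / y ≤ (Complex.exp (-((x : ℂ) * Complex.I)) * GG (ff M) x y).re := by
    intro y hy
    rw [GG_re]
    apply div_le_div_of_nonneg_right _ hy.le
    by_cases h : eta (x + y) = 0
    · simp [phi, h]
    · have h1 := cos_neg_of _ _ hxc (eta_ne h)
      rw [show 2 * (x + y) - 2 * x = 2 * y by ring] at h1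
      nlinarith [phi_nonneg M (x + y)]
  have hle : Real.pi ≤ Real.pi * (M + 1) := by
    have : (0 : ℝ) ≤ M := Nat.cast_nonneg M
    nlinarith
  have hsub : Ioc Real.pi (Real.pi * (M + 1)) ⊆ Ioi 0 := fun y hy => hpi.trans hy.1
  have h1 : ∫ y in Ioc Real.pi (Real.pi * (M + 1)), (Complex.exp (-((x : ℂ) * Complex.I)) * GG (ff M) x y).re
      ≤ ∫ y in Ioi 0, (Complex.exp (-((x : ℂ) * Complex.I)) * GG (ff M) x y).re := by
    refine setIntegral_mono_set hi3 ?_ hsub.eventuallyLE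
    refine (ae_restrict_iff' measurableSet_Ioi).2 (Eventually.of_forall fun y hy => ?_)
    exact le_trans (div_nonneg (phi_nonneg _ _) (le_of_lt hy)) (hpt y hy)
  refine le_trans ?_ h1
  refine (eta_log x M).trans ?_
  rw [intervalIntegral.integral_of_le hle]
  refine setIntegral_mono_on ?_ (hi3.mono_set hsub) measurableSet_Ioc ?_
  · have hec := eta_cont
    have : ContinuousOn (fun y => eta (x - y) / y) (Icc Real.pi (Real.pi * (M + 1))) := by
      apply ContinuousOn.div (by fun_prop) (by fun_prop)
      intro y hy
      exact (hpi.trans_le hy.1).ne'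
    exact this.integrableOn_Icc.mono_set Ioc_subset_Icc_self
  · intro y hy
    refine le_trans (le_of_eq ?_) (hpt y (hsub hy))
    rw [phi, (bmp M).one_of_mem_closedBall, mul_one]
    rw [mem_closedBall_zero_iff, Real.norm_eq_abs]
    show |x - y| ≤ Real.pi * (M + 1)
    rw [abs_le]
    constructor <;> linarith [hy.1, hy.2]

lemma ff_L2 (M : ℕ) : ∫⁻ x, ‖ff M x‖ₑ ^ 2 ≤ ENNReal.ofReal (4 * (Real.pi * (M + 1))) := by
  have : ∫⁻ x, ‖ff M x‖ₑ ^ 2 ≤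
      ∫⁻ x, (Icc (-(2 * (Real.pi * ((M : ℝ) + 1)))) (2 * (Real.pi * (M + 1)))).indicator 1 x := by
    refine lintegral_mono fun x => ?_
    by_cases hx : x ∈ Icc (-(2 * (Real.pi * ((M : ℝ) + 1)))) (2 * (Real.pi * (M + 1)))
    · rw [indicator_of_mem hx, Pi.one_apply]
      apply pow_le_one'
      rw [← ofReal_norm, ff_norm]
      exact ENNReal.ofReal_le_one.2 (phi_le_one M x)
    · have h0 : ff M x = 0 := by
        rw [ff, phi_zero, Complex.ofReal_zero, mul_zero]
        by_contra h
        push Not at h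
        exact hx ⟨(abs_lt.1 h).1.le, (abs_lt.1 h).2.le⟩
      simp [h0]
  refine this.trans ?_
  rw [lintegral_indicator_one measurableSet_Icc, Real.volume_Icc]
  apply ENNReal.ofReal_le_ofReal
  linarith

lemma g_L2 (M : ℕ) (hL : 0 ≤ LL M) (g : ℝ → ℂ)
    (hg : ∀ x, 0 ≤ x → x ≤ Real.pi * M → eta (x + Real.pi / 2) ≠ 0 → LL M ≤ ‖g x‖) :
    ENNReal.ofReal (LL M ^ 2 * (M * AA)) ≤ ∫⁻ x, ‖g x‖ₑ ^ 2 := by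
  have hpi := Real.pi_pos
  have hec := eta_cont
  have hper : ∫ x in (0:ℝ)..(Real.pi * M), eta (x + Real.pi / 2) = M * AA := by
    rw [intervalIntegral.integral_comp_add_right]
    have := eta_per.intervalIntegral_add_zsmul_eq (M : ℤ) (0 + Real.pi / 2)
      (fun a b => eta_cont.intervalIntegrable a b)
    rw [eta_int] at this
    simp only [zsmul_eq_mul, Int.cast_natCast] at this
    rw [← this]
    congr 1; ring
  have h1 : ENNReal.ofReal (LL M ^ 2 * (M * AA)) =
      ∫⁻ x in Ioc 0 (Real.pi * M), ENNReal.ofReal (LL M ^ 2 * eta (x + Real.pi / 2)) := by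
    rw [← ofReal_integral_eq_lintegral_ofReal, integral_const_mul, ← intervalIntegral.integral_of_le
      (by positivity), hper]
    · apply Continuous.integrableOn_Ioc; fun_prop
    · exact Eventually.of_forall fun x => mul_nonneg (sq_nonneg _) (eta_nonneg _)
  rw [h1]
  refine le_trans (setLIntegral_mono' measurableSet_Ioc fun x hx => ?_) (setLIntegral_le_lintegral _ _)
  by_cases h : eta (x + Real.pi / 2) = 0
  · simp [h]
  · rw [← ofReal_norm, ← ENNReal.ofReal_pow (norm_nonneg _)]
    apply ENNReal.ofReal_le_ofReal
    have h2 := hg x hx.1.le hx.2 h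
    calc LL M ^ 2 * eta (x + Real.pi / 2) ≤ LL M ^ 2 * 1 := by
          gcongr; exact eta_le_one _
      _ ≤ ‖g x‖ ^ 2 := by rw [mul_one]; gcongr

theorem stmt_7 :
    ¬ ∃ C : ℝ, 0 < C ∧ ∀ f : SchwartzMap ℝ ℂ, ∀ g : ℝ → ℂ,
      (∀ x : ℝ,
        Filter.Tendsto
          (fun p : ℝ × ℝ => ∫ y in {y : ℝ | p.1 ≤ |y| ∧ |y| ≤ p.2},
            Complex.exp (Complex.I * ((|y| : ℝ) : ℂ)) * f (x - y) / (y : ℂ))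
          ((nhdsWithin (0 : ℝ) (Set.Ioi 0)) ×ˢ Filter.atTop) (nhds (g x))) →
      eLpNorm g 2 volume ≤ ENNReal.ofReal C * eLpNorm (fun y => f y) 2 volume := by
  rintro ⟨C, hC, H⟩
  have hA := AA_pos
  have hpi := Real.pi_pos
  obtain ⟨M, hM1, hM2⟩ := ((LL_tendsto.eventually_ge_atTop (1 + 8 * Real.pi * C ^ 2 / AA)).and
    (eventually_ge_atTop 1)).exists
  have hq : 0 ≤ 8 * Real.pi * C ^ 2 / AA := by positivity
  have hL : 1 ≤ LL M := by linarith
  obtain ⟨K, hK⟩ := (ff_contDiff M (n := 1)).lipschitzWith_of_hasCompactSupport (ff_supp M) (by simp)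
  have hcont : Continuous (ff M) := (ff_contDiff M (n := 1)).continuous
  have hi : ∀ x, IntegrableOn (GG (ff M) x) (Ioi 0) := fun x =>
    GG_int (ff M) hcont K hK (2 * (Real.pi * (M + 1)))
      (fun y hy => by rw [ff, phi_zero M y hy, Complex.ofReal_zero, mul_zero]) x
  have h := H ((ff_supp M).toSchwartzMap (ff_contDiff M)) (fun x => ∫ y in Ioi 0, GG (ff M) x y)
    (fun x => pv_tendsto (ff M) hcont x (hi x))
  have h' : eLpNorm (fun x => ∫ y in Ioi 0, GG (ff M) x y) 2 volume
      ≤ ENNReal.ofReal C * eLpNorm (ff M) 2 volume := h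
  have e : ∀ u : ℝ → ℂ, eLpNorm u 2 volume ^ 2 = ∫⁻ x, ‖u x‖ₑ ^ 2 := by
    intro u
    have := eLpNorm_nnreal_pow_eq_lintegral (f := u) (p := 2) (μ := volume) (by norm_num)
    simpa using this
  have h2 := pow_le_pow_left' h' 2
  rw [mul_pow, e, e] at h2
  have h3 := (g_L2 M (by linarith) _ (fun x a b c => g_lower M x a b c (hi x))).trans
    (h2.trans (mul_le_mul_right (ff_L2 M) _))
  rw [← ENNReal.ofReal_pow hC.le, ← ENNReal.ofReal_mul (by positivity),
    ENNReal.ofReal_le_ofReal_iff (by positivity)] at h3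
  have hM : (1 : ℝ) ≤ M := by exact_mod_cast hM2
  have h4 : LL M ^ 2 * (M * AA) ≤ M * (8 * Real.pi * C ^ 2) := by
    refine h3.trans ?_
    have : 0 ≤ C ^ 2 * (4 * Real.pi) := by positivity
    nlinarith
  have h5 : LL M ^ 2 * AA ≤ 8 * Real.pi * C ^ 2 := by
    have : (M : ℝ) * (LL M ^ 2 * AA) ≤ M * (8 * Real.pi * C ^ 2) := by linarith
    exact le_of_mul_le_mul_left this (by linarith)
  rw [← le_div_iff₀ hA] at h5
  nlinarith
end

section
/- There exists a universal constant C > 0 with the following property. Let n ≥ 2 be a real number, set λ := 2^{1/n}, and let ψ₀ : ℝ → [0, 1] be a C¹ function supported in (1/λ, λ²) ∪ (−λ², −1/λ) with ψ₀ ≡ 1 on [1, λ] ∪ [−λ, −1] and |ψ₀'(t)| ≤ 100 n for all t. Then for every nonnegative integer j, every h ∈ (0, 1], and every ξ ∈ ℝ: | ∫_ℝ e^{i 2^j (|η|^n − |ξ − hη|^n)} · (ψ₀(η)/η) · (ψ₀(ξ − hη)/(ξ − hη)) dη | ≤ (C/n) · 𝟙_{[−n·2^{−j/4}, n·2^{−j/4}]}(ξ)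 + C · 2^{−j/4} · 𝟙_{[−4, 4]}(ξ). -/
open MeasureTheory Filter Set
open scoped ENNReal Topology

lemma aux_G_deriv (m : ℝ) (hm : 0 ≤ m) (t : ℝ) :
    HasDerivAt (fun t : ℝ => |t| ^ m * t) ((m + 1) * |t| ^ m) t := by
  rcases lt_trichotomy t 0 with ht | ht | ht
  · have h1 : HasDerivAt (fun t : ℝ => (-t) ^ m * t) ((m + 1) * |t| ^ m) t := by
      have h2 := ((hasDerivAt_neg t).rpow_const (p := m) (Or.inl (by linarith))).mul (hasDerivAt_id t)
      refine HasDerivAt.congr_deriv h2 ?_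
      have h3 : (-t) ^ (m - 1) = (-t) ^ m / (-t) := by
        rw [Real.rpow_sub_one (by linarith)]
      rw [h3, abs_of_neg ht]
      have : t ≠ 0 := ht.ne
      simp only [id]
      field_simp
    refine h1.congr_of_eventuallyEq ?_
    filter_upwards [Iio_mem_nhds ht] with s hs
    rw [abs_of_neg hs]
  · subst ht
    rw [hasDerivAt_iff_tendsto_slope]
    have hc : Continuous (fun t : ℝ => |t| ^ m) := continuous_abs.rpow_const (fun _ => Or.inr hm)
    have h0 : (m + 1) * |(0:ℝ)| ^ m = |(0:ℝ)| ^ m := by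
      rcases hm.eq_or_lt with h | h
      · rw [← h]; simp
      · rw [abs_zero, Real.zero_rpow h.ne']; simp
    rw [h0]
    refine ((hc.tendsto 0).mono_left nhdsWithin_le_nhds).congr' ?_
    filter_upwards [self_mem_nhdsWithin] with s hs
    have : s ≠ 0 := hs
    simp [slope_def_field, this]
  · have h1 : HasDerivAt (fun t : ℝ => t ^ m * t) ((m + 1) * |t| ^ m) t := by
      have h2 := ((hasDerivAt_id t).rpow_const (p := m) (Or.inl (by simpa using ht.ne'))).mul (hasDerivAt_id t)
      refine HasDerivAt.congr_deriv h2 ?_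
      simp only [id]
      rw [Real.rpow_sub_one ht.ne', abs_of_pos ht]
      field_simp
    refine h1.congr_of_eventuallyEq ?_
    filter_upwards [Ioi_mem_nhds ht] with s hs
    rw [abs_of_pos hs]

lemma aux_key (x u m : ℝ) (hx : 0 < x) (hm : 0 ≤ m) :
    x ^ m * |x - u| / 2 ≤ |x ^ m * x - |u| ^ m * u| := by
  have hP : 0 < x ^ m := Real.rpow_pos_of_pos hx m
  have hQ : 0 ≤ |u| ^ m := Real.rpow_nonneg (abs_nonneg u) m
  rcases le_total |u| x with h | h
  · have hPQ : |u| ^ m ≤ x ^ m := Real.rpow_le_rpow (abs_nonneg u) h hm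
    have h' := abs_le.1 h
    rw [abs_of_nonneg (by linarith : 0 ≤ x - u)]
    refine le_trans ?_ (le_abs_self _)
    rcases le_total 0 u with hu | hu
    · nlinarith [mul_nonneg hu (sub_nonneg.2 hPQ), mul_nonneg hP.le (by linarith : 0 ≤ x - u)]
    · nlinarith [mul_nonneg hQ (neg_nonneg.2 hu), mul_nonneg hP.le (by linarith : 0 ≤ x + u)]
  · have hPQ : x ^ m ≤ |u| ^ m := Real.rpow_le_rpow hx.le h hm
    rcases le_total 0 u with hu | hu
    · rw [abs_of_nonneg hu] at *
      rw [abs_sub_comm, abs_of_nonneg (by linarith : 0 ≤ u - x), abs_sub_comm]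
      refine le_trans ?_ (le_abs_self _)
      nlinarith [mul_nonneg hu (sub_nonneg.2 hPQ), mul_nonneg hP.le (by linarith : 0 ≤ u - x)]
    · rw [abs_of_nonneg (by linarith : 0 ≤ x - u)]
      refine le_trans ?_ (le_abs_self _)
      nlinarith [mul_nonneg (neg_nonneg.2 hu) (sub_nonneg.2 hPQ), mul_nonneg hP.le (by linarith : 0 ≤ x - u)]

lemma aux_ibp (N x₀ r μ A A' K p q : ℝ) (f f' f'' a a' : ℝ → ℝ)
    (hf : ∀ x, HasDerivAt f (f' x) x) (hf' : ∀ x, HasDerivAt f' (f'' x) x)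
    (hf'' : Continuous f'') (ha : ∀ x, HasDerivAt a (a' x) x) (ha' : Continuous a')
    (hN : 0 < N) (hr : 0 < r) (hμ : 0 < μ) (hA : 0 ≤ A) (hA' : 0 ≤ A') (hK : 0 ≤ K) (hpq : p ≤ q)
    (bA : ∀ x, |a x| ≤ A) (bA' : ∀ x, |a' x| ≤ A')
    (bK : ∀ x ∈ Icc p q, |f'' x| ≤ K)
    (bμ : ∀ x ∈ Icc p q, μ * |x - x₀| ≤ |f' x|)
    (br : ∀ x ∈ Icc p q, r ≤ |x - x₀|) :
    ‖∫ x in p..q, Complex.exp (Complex.I * ((N * f x : ℝ) : ℂ)) * ((a x : ℝ) : ℂ)‖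
      ≤ (1 / N) * (2 * A / (μ * r) + A' * (q - p) / (μ * r) + 2 * A * K / (μ ^ 2 * r)) := by
  have hbig : ∀ x ∈ Icc p q, μ * r ≤ |f' x| := fun x hx =>
    (mul_le_mul_of_nonneg_left (br x hx) hμ.le).trans (bμ x hx)
  have hne : ∀ x ∈ Icc p q, f' x ≠ 0 := fun x hx h0 => by
    have := hbig x hx
    rw [h0, abs_zero] at this
    nlinarith [mul_pos hμ hr]
  have hxne : ∀ x ∈ Icc p q, x - x₀ ≠ 0 := fun x hx h0 => by
    have := br x hx
    rw [h0, abs_zero] at this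
    linarith
  have cf : Continuous f := continuous_iff_continuousAt.2 fun x => (hf x).continuousAt
  have cf' : Continuous f' := continuous_iff_continuousAt.2 fun x => (hf' x).continuousAt
  have ca : Continuous a := continuous_iff_continuousAt.2 fun x => (ha x).continuousAt
  have hu : uIcc p q = Icc p q := uIcc_of_le hpq
  set E : ℝ → ℂ := fun x => Complex.exp (Complex.I * ((N * f x : ℝ) : ℂ)) with hE
  have nE : ∀ x, ‖E x‖ = 1 := fun x => by
    simp only [hE]; rw [mul_comm]; exact Complex.norm_exp_ofReal_mul_I _
  have cE : Continuous E := by simp only [hE]; fun_prop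
  have dE : ∀ x, HasDerivAt E (E x * (Complex.I * ((N * f' x : ℝ) : ℂ))) x := fun x => by
    have h1 : HasDerivAt (fun x => ((N * f x : ℝ) : ℂ)) ((N * f' x : ℝ) : ℂ) x :=
      ((hf x).const_mul N).ofReal_comp
    exact (h1.const_mul Complex.I).cexp
  set g : ℝ → ℝ := fun x => a x / f' x with hg
  set g' : ℝ → ℝ := fun x => (a' x * f' x - a x * f'' x) / (f' x) ^ 2 with hg'
  have dg : ∀ x ∈ Icc p q, HasDerivAt g (g' x) x := fun x hx => (ha x).div (hf' x) (hne x hx)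
  have cg' : ContinuousOn g' (Icc p q) := by
    refine ContinuousOn.div (by fun_prop) (by fun_prop) fun x hx => pow_ne_zero 2 (hne x hx)
  set c : ℂ := Complex.I * (N : ℂ) with hc
  have hNc : (N : ℂ) ≠ 0 := by exact_mod_cast hN.ne'
  have hc0 : c ≠ 0 := mul_ne_zero Complex.I_ne_zero hNc
  have nc : ‖c‖ = N := by simp [hc, abs_of_pos hN]
  have dH : ∀ x ∈ uIcc p q, HasDerivAt (fun x => E x * ((g x : ℝ) : ℂ))
      (c * (E x * (a x : ℂ)) + E x * (g' x : ℂ)) x := fun x hx => by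
    rw [hu] at hx
    have h2 := (dE x).mul (dg x hx).ofReal_comp
    refine HasDerivAt.congr_deriv h2 ?_
    have h3 : (f' x : ℂ) ≠ 0 := by exact_mod_cast hne x hx
    simp only [hg, hc]
    push_cast
    field_simp
  have i1 : IntervalIntegrable (fun x => c * (E x * (a x : ℂ))) volume p q := by
    apply Continuous.intervalIntegrable; fun_prop
  have i2 : IntervalIntegrable (fun x => E x * (g' x : ℂ)) volume p q := by
    apply ContinuousOn.intervalIntegrable
    rw [hu]
    exact cE.continuousOn.mul (Complex.continuous_ofReal.comp_continuousOn cg')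
  have ftc := intervalIntegral.integral_eq_sub_of_hasDerivAt dH (i1.add i2)
  rw [intervalIntegral.integral_add i1 i2, intervalIntegral.integral_const_mul] at ftc
  -- boundary terms
  have bg : ∀ x ∈ Icc p q, ‖E x * ((g x : ℝ) : ℂ)‖ ≤ A / (μ * r) := fun x hx => by
    rw [norm_mul, nE, one_mul, Complex.norm_real, Real.norm_eq_abs]
    simp only [hg]
    rw [abs_div]
    exact div_le_div₀ hA (bA x) (mul_pos hμ hr) (hbig x hx)
  -- the integral of the derivative
  set B : ℝ → ℝ := fun x => A' / (μ * r) + A * K / μ ^ 2 * (1 / (x - x₀) ^ 2) with hB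
  have bg' : ∀ x ∈ Icc p q, ‖E x * ((g' x : ℝ) : ℂ)‖ ≤ B x := fun x hx => by
    rw [norm_mul, nE, one_mul, Complex.norm_real, Real.norm_eq_abs]
    have e1 : g' x = a' x / f' x - a x * f'' x / (f' x) ^ 2 := by
      simp only [hg']
      have := hne x hx
      field_simp
    rw [e1]
    refine (abs_sub _ _).trans (add_le_add ?_ ?_)
    · rw [abs_div]
      exact div_le_div₀ hA' (bA' x) (mul_pos hμ hr) (hbig x hx)
    · rw [abs_div, abs_mul, abs_pow]
      have e2 : A * K / μ ^ 2 * (1 / (x - x₀) ^ 2) = A * K / (μ * |x - x₀|) ^ 2 := by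
        rw [mul_pow, sq_abs]
        have := hxne x hx
        field_simp
      rw [e2]
      have h5 : 0 < μ * |x - x₀| := mul_pos hμ (abs_pos.2 (hxne x hx))
      refine div_le_div₀ (mul_nonneg hA hK) (mul_le_mul (bA x) (bK x hx) (abs_nonneg _) hA)
        (pow_pos h5 2) (pow_le_pow_left₀ h5.le (bμ x hx) 2)
  have dB : ∀ x ∈ uIcc p q, HasDerivAt
      (fun x => A' / (μ * r) * x + A * K / μ ^ 2 * (-(x - x₀)⁻¹)) (B x) x := fun x hx => by
    rw [hu] at hx
    have h1 := ((hasDerivAt_id x).sub_const x₀).inv (hxne x hx)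
    have h2 := ((hasDerivAt_id x).const_mul (A' / (μ * r))).add (h1.neg.const_mul (A * K / μ ^ 2))
    refine HasDerivAt.congr_deriv h2 ?_
    simp only [hB, id]
    ring
  have cB : ContinuousOn B (Icc p q) := by
    have : ContinuousOn (fun x => 1 / (x - x₀) ^ 2) (Icc p q) :=
      ContinuousOn.div (by fun_prop) (by fun_prop) fun x hx => pow_ne_zero 2 (hxne x hx)
    exact continuousOn_const.add (continuousOn_const.mul this)
  have iB : IntervalIntegrable B volume p q := by
    apply ContinuousOn.intervalIntegrable; rwa [hu]
  have ftcB := intervalIntegral.integral_eq_sub_of_hasDerivAt dB iB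
  have hI2 : ‖∫ x in p..q, E x * (g' x : ℂ)‖ ≤ A' * (q - p) / (μ * r) + 2 * A * K / (μ ^ 2 * r) := by
    have h1 : ‖∫ x in p..q, E x * (g' x : ℂ)‖ ≤ ∫ x in p..q, B x := by
      refine intervalIntegral.norm_integral_le_of_norm_le hpq ?_ iB
      exact Eventually.of_forall fun x hx => bg' x (Ioc_subset_Icc_self hx)
    refine h1.trans ?_
    rw [ftcB]
    have hp : p ∈ Icc p q := left_mem_Icc.2 hpq
    have hq : q ∈ Icc p q := right_mem_Icc.2 hpq
    have inv : ∀ x ∈ Icc p q, |(x - x₀)⁻¹| ≤ 1 / r := fun x hx => by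
      rw [abs_inv, one_div]
      exact inv_anti₀ hr (br x hx)
    have j1 := (abs_le.1 (inv p hp)).2
    have j2 := (abs_le.1 (inv q hq)).1
    have hAK : 0 ≤ A * K / μ ^ 2 := by positivity
    have e3 : 2 * A * K / (μ ^ 2 * r) = A * K / μ ^ 2 * (1 / r + 1 / r) := by
      field_simp; ring
    have e4 : A' * (q - p) / (μ * r) = A' / (μ * r) * q - A' / (μ * r) * p := by ring
    rw [e3, e4]
    nlinarith [mul_le_mul_of_nonneg_left (by linarith : (p - x₀)⁻¹ - (q - x₀)⁻¹ ≤ 1 / r + 1 / r) hAK]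
  have hmain : N * ‖∫ x in p..q, E x * (a x : ℂ)‖ ≤
      2 * A / (μ * r) + A' * (q - p) / (μ * r) + 2 * A * K / (μ ^ 2 * r) := by
    have e5 : c * (∫ x in p..q, E x * (a x : ℂ)) = E q * (g q : ℂ) - E p * (g p : ℂ)
        - ∫ x in p..q, E x * (g' x : ℂ) := by rw [← ftc]; ring
    rw [← nc, ← norm_mul, e5]
    refine (norm_sub_le _ _).trans ?_
    have := norm_sub_le (E q * (g q : ℂ)) (E p * (g p : ℂ))
    have k1 := bg p (left_mem_Icc.2 hpq)
    have k2 := bg q (right_mem_Icc.2 hpq)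
    have e6 : 2 * A / (μ * r) = A / (μ * r) + A / (μ * r) := by ring
    rw [e6]
    linarith
  rw [one_div, ← div_eq_inv_mul, le_div_iff₀ hN, mul_comm]
  exact hmain

/-- lower bound for the phase derivative -/
lemma aux_lower (n h ξ : ℝ) (hn : 2 ≤ n) (hh : 0 < h) (hh1 : h ≤ 1) (hξ : |ξ| ≤ 4) :
    ∃ x₀ : ℝ, ∀ x : ℝ, 1 / 2 ≤ x → x ≤ 2 → 1 / 2 ≤ x ^ (n - 2) → |ξ - h * x| ^ (n - 2) ≤ 4 →
      |ξ - h * x| ≤ 2 →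
      n * |ξ| / 1024 * |x - x₀| ≤
        |n * (|x| ^ (n - 2) * x) + h * n * (|ξ - h * x| ^ (n - 2) * (ξ - h * x))| := by
  have hn0 : 0 < n := by linarith
  have key : ∀ x₀ : ℝ, (∀ x : ℝ, 1 / 2 ≤ x → x ≤ 2 → 1 / 2 ≤ x ^ (n - 2) →
      |ξ - h * x| ^ (n - 2) ≤ 4 → |ξ - h * x| ≤ 2 →
      |ξ| / 1024 * |x - x₀| ≤
        |x ^ (n - 2) * x + h * (|ξ - h * x| ^ (n - 2) * (ξ - h * x))|) →
      ∀ x : ℝ, 1 / 2 ≤ x → x ≤ 2 → 1 / 2 ≤ x ^ (n - 2) →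
      |ξ - h * x| ^ (n - 2) ≤ 4 → |ξ - h * x| ≤ 2 →
      n * |ξ| / 1024 * |x - x₀| ≤
        |n * (|x| ^ (n - 2) * x) + h * n * (|ξ - h * x| ^ (n - 2) * (ξ - h * x))| := by
    intro x₀ H x h1 h2 h3 h4 h5
    have := H x h1 h2 h3 h4 h5
    have e : n * (|x| ^ (n - 2) * x) + h * n * (|ξ - h * x| ^ (n - 2) * (ξ - h * x))
        = n * (x ^ (n - 2) * x + h * (|ξ - h * x| ^ (n - 2) * (ξ - h * x))) := by
      rw [abs_of_nonneg (by linarith : 0 ≤ x)]; ring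
    rw [e, abs_mul, abs_of_pos hn0]
    calc n * |ξ| / 1024 * |x - x₀| = n * (|ξ| / 1024 * |x - x₀|) := by ring
      _ ≤ _ := mul_le_mul_of_nonneg_left this hn0.le
  have hξ0 := abs_nonneg ξ
  by_cases hs : h ≤ 1 / 64
  · refine ⟨0, key 0 ?_⟩
    intro x h1 h2 h3 h4 h5
    rw [sub_zero, abs_of_nonneg (by linarith : 0 ≤ x)]
    refine le_trans ?_ (le_abs_self _)
    have h6 : |h * (|ξ - h * x| ^ (n - 2) * (ξ - h * x))| ≤ 1 / 64 * (4 * 2) := by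
      rw [abs_mul, abs_mul, abs_of_pos hh, abs_of_nonneg (Real.rpow_nonneg (abs_nonneg _) _)]
      have h4' := Real.rpow_nonneg (abs_nonneg (ξ - h * x)) (n - 2)
      refine mul_le_mul hs (mul_le_mul h4 h5 (abs_nonneg _) (by norm_num)) (by positivity) (by norm_num)
    have h7 := (abs_le.1 h6).1
    have h8 : |ξ| * x ≤ 4 * 2 := mul_le_mul hξ h2 (by linarith) (by norm_num)
    nlinarith
  · push Not at hs
    set k : ℝ := h ^ (1 / (n - 1)) with hk
    have hn1 : 0 < n - 1 := by linarith
    have hk0 : 0 < k := Real.rpow_pos_of_pos hh _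
    have hk1 : k ≤ 1 := Real.rpow_le_one hh.le hh1 (by positivity)
    have hkh : h ≤ k := by
      have := Real.rpow_le_rpow_of_exponent_ge hh hh1 (show 1 / (n - 1) ≤ 1 by
        rw [div_le_one hn1]; linarith)
      rwa [Real.rpow_one] at this
    have hkp : k ^ (n - 2) * k = h := by
      have : k ^ (n - 2) * k = k ^ (n - 1) := by
        rw [show n - 1 = (n - 2) + 1 by ring, Real.rpow_add_one hk0.ne']
      rw [this, hk, ← Real.rpow_mul hh.le, one_div, inv_mul_cancel₀ hn1.ne', Real.rpow_one]
    have low : ∀ x : ℝ, 1 / 2 ≤ x → 1 / 2 ≤ x ^ (n - 2) →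
        1 / 4 * |(1 - k * h) * x + k * ξ| ≤
        |x ^ (n - 2) * x + h * (|ξ - h * x| ^ (n - 2) * (ξ - h * x))| := by
      intro x h1 h3
      have := aux_key x (k * (h * x - ξ)) (n - 2) (by linarith) (by linarith)
      have e1 : |k * (h * x - ξ)| ^ (n - 2) * (k * (h * x - ξ))
          = - (h * (|ξ - h * x| ^ (n - 2) * (ξ - h * x))) := by
        rw [abs_mul, abs_of_pos hk0, Real.mul_rpow hk0.le (abs_nonneg _), abs_sub_comm]
        linear_combination (-|ξ - h * x| ^ (n - 2) * (ξ - h * x)) * hkp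
      rw [e1, sub_neg_eq_add] at this
      have e2 : x - k * (h * x - ξ) = (1 - k * h) * x + k * ξ := by ring
      rw [e2] at this
      refine le_trans ?_ this
      nlinarith [abs_nonneg ((1 - k * h) * x + k * ξ)]
    have hkh1 : 0 ≤ 1 - k * h := by nlinarith
    by_cases hσ : |ξ| / 256 ≤ 1 - k * h ∧ 1 - k * h ≠ 0
    · obtain ⟨hσ, hσ0⟩ := hσ
      refine ⟨-(k * ξ) / (1 - k * h), key _ ?_⟩
      intro x h1 h2 h3 h4 h5
      refine le_trans ?_ (low x h1 h3)
      have e : (1 - k * h) * x + k * ξ = (1 - k * h) * (x - -(k * ξ) / (1 - k * h)) := by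
        field_simp; ring
      rw [e, abs_mul, abs_of_nonneg hkh1]
      nlinarith [mul_le_mul_of_nonneg_right hσ (abs_nonneg (x - -(k * ξ) / (1 - k * h)))]
    · have hσ' : 1 - k * h ≤ |ξ| / 256 := by
        by_contra hc
        push Not at hc
        exact hσ ⟨hc.le, by linarith⟩
      refine ⟨0, key _ ?_⟩
      intro x h1 h2 h3 h4 h5
      refine le_trans ?_ (low x h1 h3)
      rw [sub_zero, abs_of_nonneg (by linarith : 0 ≤ x)]
      have t1 : |k * ξ| ≤ |(1 - k * h) * x + k * ξ| + |(1 - k * h) * x| := by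
        have := abs_sub ((1 - k * h) * x + k * ξ) ((1 - k * h) * x)
        rwa [add_sub_cancel_left] at this
      rw [abs_mul, abs_of_pos hk0, abs_of_nonneg (mul_nonneg hkh1 (by linarith : 0 ≤ x))] at t1
      have t2 : (1 - k * h) * x ≤ |ξ| / 256 * 2 := mul_le_mul hσ' h2 (by linarith) (by positivity)
      have t3 : 1 / 64 * |ξ| ≤ k * |ξ| := mul_le_mul_of_nonneg_right (by linarith) hξ0
      nlinarith [mul_le_mul_of_nonneg_left h2 hξ0]

lemma aux_const (n ξ r N μ d : ℝ) (hn : 2 ≤ n) (hr : 0 < r) (hr1 : r ≤ 1) (hN : N * r ^ 4 = 1)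
    (hμ : μ = n * |ξ| / 1024) (hξ : n * r ≤ |ξ|) (hd : d ≤ 2) :
    (1 / N) * (2 * 4 / (μ * r) + (808 * n) * d / (μ * r) + 2 * 4 * (4 * n ^ 2) / (μ ^ 2 * r))
      ≤ 40000000 * r := by
  have hn0 : 0 < n := by linarith
  have hN' : 1 / N = r ^ 4 := by
    have : N ≠ 0 := by rintro rfl; simp at hN
    field_simp; linarith
  have hμ1 : n ^ 2 * r / 1024 ≤ μ := by
    rw [hμ]; nlinarith [mul_le_mul_of_nonneg_left hξ hn0.le]
  have hμ0 : 0 < n ^ 2 * r / 1024 := by positivity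
  have hμ' : 0 < μ := lt_of_lt_of_le hμ0 hμ1
  have b1 : 2 * 4 / (μ * r) ≤ 8 * 1024 / r ^ 3 := by
    calc 2 * 4 / (μ * r) ≤ 2 * 4 / ((n ^ 2 * r / 1024) * r) := by gcongr
      _ = 8 * 1024 / r ^ 3 * (r / n ^ 2) := by field_simp; norm_num
      _ ≤ 8 * 1024 / r ^ 3 * 1 := by
        gcongr; rw [div_le_one (by positivity)]; nlinarith
      _ = _ := by ring
  have b2 : (808 * n) * d / (μ * r) ≤ 1616 * 1024 / r ^ 3 := by
    calc (808 * n) * d / (μ * r) ≤ (808 * n) * 2 / ((n ^ 2 * r / 1024) * r) := by gcongr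
      _ = 1616 * 1024 / r ^ 3 * (r / n) := by field_simp; norm_num
      _ ≤ 1616 * 1024 / r ^ 3 * 1 := by
        gcongr; rw [div_le_one (by positivity)]; nlinarith
      _ = _ := by ring
  have b3 : 2 * 4 * (4 * n ^ 2) / (μ ^ 2 * r) ≤ 32 * 1024 ^ 2 / r ^ 3 := by
    calc 2 * 4 * (4 * n ^ 2) / (μ ^ 2 * r) ≤ 2 * 4 * (4 * n ^ 2) / ((n ^ 2 * r / 1024) ^ 2 * r) := by
          gcongr
      _ = 32 * 1024 ^ 2 / r ^ 3 * (1 / n ^ 2) := by field_simp; norm_num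
      _ ≤ 32 * 1024 ^ 2 / r ^ 3 * 1 := by
        gcongr; rw [div_le_one (by positivity)]; nlinarith
      _ = _ := by ring
  rw [hN']
  calc r ^ 4 * (2 * 4 / (μ * r) + (808 * n) * d / (μ * r) + 2 * 4 * (4 * n ^ 2) / (μ ^ 2 * r))
      ≤ r ^ 4 * (8 * 1024 / r ^ 3 + 1616 * 1024 / r ^ 3 + 32 * 1024 ^ 2 / r ^ 3) := by gcongr
    _ = (8 * 1024 + 1616 * 1024 + 32 * 1024 ^ 2) * r := by field_simp
    _ ≤ _ := by gcongr; norm_num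

lemma aux_half (n l h ξ r N : ℝ) (b b' : ℝ → ℝ) (hn : 2 ≤ n) (hl : 1 < l) (hl2 : l ^ 2 ≤ 2)
    (hln : l ^ n = 2) (hh : 0 < h) (hh1 : h ≤ 1) (hξ4 : |ξ| ≤ 4) (hr : 0 < r) (hr1 : r ≤ 1)
    (hN : N * r ^ 4 = 1) (hξ : n * r ≤ |ξ|)
    (db : ∀ t, HasDerivAt b (b' t) t) (cb' : Continuous b') (bb : ∀ t, |b t| ≤ 2)
    (bb' : ∀ t, |b' t| ≤ 202 * n) (sb : ∀ t, b t ≠ 0 → 1 / l ≤ |t| ∧ |t| ≤ l ^ 2) :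
    ‖∫ x in Ioi (0:ℝ), Complex.exp (Complex.I * ((N * (|x| ^ n - |ξ - h * x| ^ n) : ℝ) : ℂ)) *
      ((b x * b (ξ - h * x) : ℝ) : ℂ)‖ ≤ 100000000 * r := by
  have hn0 : 0 < n := by linarith
  have hl0 : 0 < l := by linarith
  have hN0 : 0 < N := by
    by_contra hc
    push Not at hc
    nlinarith [pow_pos hr 4]
  have hll : 1 / 2 ≤ 1 / l := one_div_le_one_div_of_le hl0 (by nlinarith)
  set F : ℝ → ℂ := fun x => Complex.exp (Complex.I * ((N * (|x| ^ n - |ξ - h * x| ^ n) : ℝ) : ℂ)) *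
      ((b x * b (ξ - h * x) : ℝ) : ℂ) with hF
  set α := max (1 / l) ((ξ - l ^ 2) / h) with hα
  set β := min (l ^ 2) ((ξ + l ^ 2) / h) with hβ
  have hJ : ∀ x, x ∈ Icc α β ↔ (1 / l ≤ x ∧ x ≤ l ^ 2 ∧ |ξ - h * x| ≤ l ^ 2) := by
    intro x
    rw [mem_Icc, hα, hβ, max_le_iff, le_min_iff, div_le_iff₀ hh, le_div_iff₀ hh, abs_le]
    constructor
    · rintro ⟨⟨h1, h2⟩, h3, h4⟩
      exact ⟨h1, h3, by linarith, by linarith⟩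
    · rintro ⟨h1, h3, h4, h5⟩
      exact ⟨⟨h1, by linarith⟩, h3, by linarith⟩
  have e1 : ∫ x in Ioi (0:ℝ), F x = ∫ x in Icc α β, F x := by
    refine setIntegral_eq_of_subset_of_forall_sdiff_eq_zero measurableSet_Ioi ?_ ?_
    · intro x hx
      have := ((hJ x).1 hx).1
      exact lt_of_lt_of_le (by positivity) this
    · rintro x ⟨hx0, hx⟩
      have hx0 : 0 < x := hx0
      have : b x * b (ξ - h * x) = 0 := by
        by_contra hc
        have h1 := sb x (left_ne_zero_of_mul hc)
        have h2 := sb _ (right_ne_zero_of_mul hc)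
        rw [abs_of_pos hx0] at h1
        exact hx ((hJ x).2 ⟨h1.1, h1.2, h2.2⟩)
      simp only [hF]
      rw [this]; simp
  rw [e1]
  rcases lt_or_ge β α with hαβ | hαβ
  · rw [Icc_eq_empty (not_le.2 hαβ)]
    simp; positivity
  rw [integral_Icc_eq_integral_Ioc, ← intervalIntegral.integral_of_le hαβ]
  -- power bounds
  have pw : ∀ w : ℝ, |w| ≤ l ^ 2 → |w| ^ (n - 2) ≤ 4 := by
    intro w hw
    rcases le_total |w| 1 with h1 | h1
    · exact (Real.rpow_le_one (abs_nonneg w) h1 (by linarith)).trans (by norm_num)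
    · calc |w| ^ (n - 2) ≤ |w| ^ n := Real.rpow_le_rpow_of_exponent_le h1 (by linarith)
        _ ≤ (l ^ 2) ^ n := Real.rpow_le_rpow (abs_nonneg w) hw hn0.le
        _ = (l ^ n) ^ 2 := by
          rw [← Real.rpow_natCast, ← Real.rpow_natCast, ← Real.rpow_mul hl0.le,
            ← Real.rpow_mul hl0.le, mul_comm]
        _ = 4 := by rw [hln]; norm_num
  have pl : ∀ x : ℝ, 1 / l ≤ x → 1 / 2 ≤ x ^ (n - 2) := by
    intro x hx
    rcases le_total x 1 with h1 | h1
    · have hx0 : 0 < x := lt_of_lt_of_le (by positivity) hx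
      calc (1:ℝ) / 2 = (1 / l) ^ n := by rw [Real.div_rpow zero_le_one hl0.le, hln, Real.one_rpow]
        _ ≤ x ^ n := Real.rpow_le_rpow (by positivity) hx hn0.le
        _ ≤ x ^ (n - 2) := Real.rpow_le_rpow_of_exponent_ge hx0 h1 (by linarith)
    · exact le_trans (by norm_num) (Real.one_le_rpow h1 (by linarith))
  obtain ⟨x₀, hx₀⟩ := aux_lower n h ξ hn hh hh1 hξ4
  -- phase and amplitude
  set f : ℝ → ℝ := fun x => |x| ^ n - |ξ - h * x| ^ n with hf
  set f' : ℝ → ℝ := fun x =>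
    n * (|x| ^ (n - 2) * x) + h * n * (|ξ - h * x| ^ (n - 2) * (ξ - h * x)) with hf'
  set f'' : ℝ → ℝ := fun x =>
    n * (n - 1) * (|x| ^ (n - 2) - h ^ 2 * |ξ - h * x| ^ (n - 2)) with hf''
  have dw : ∀ x : ℝ, HasDerivAt (fun x => ξ - h * x) (-h) x := fun x => by
    simpa using ((hasDerivAt_id x).const_mul h).const_sub ξ
  have df : ∀ x, HasDerivAt f (f' x) x := fun x => by
    have h1 := hasDerivAt_abs_rpow x (p := n) (by linarith)
    have h2 := (hasDerivAt_abs_rpow (ξ - h * x) (p := n) (by linarith)).comp x (dw x)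
    refine (h1.sub h2).congr_deriv ?_
    simp only [hf']; ring
  have df' : ∀ x, HasDerivAt f' (f'' x) x := fun x => by
    have h1 := aux_G_deriv (n - 2) (by linarith) x
    have h2 := (aux_G_deriv (n - 2) (by linarith) (ξ - h * x)).comp x (dw x)
    refine ((h1.const_mul n).add (h2.const_mul (h * n))).congr_deriv ?_
    simp only [hf'']; ring
  have cf'' : Continuous f'' := by
    have h1 : Continuous (fun t : ℝ => |t| ^ (n - 2)) :=
      continuous_abs.rpow_const (fun _ => Or.inr (by linarith))
    have h2 : Continuous (fun t : ℝ => |ξ - h * t| ^ (n - 2)) := h1.comp (by fun_prop)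
    exact continuous_const.mul (h1.sub (continuous_const.mul h2))
  set a : ℝ → ℝ := fun x => b x * b (ξ - h * x) with ha
  set a' : ℝ → ℝ := fun x => b' x * b (ξ - h * x) + b x * (b' (ξ - h * x) * (-h)) with ha'
  have cb : Continuous b := continuous_iff_continuousAt.2 fun x => (db x).continuousAt
  have da : ∀ x, HasDerivAt a (a' x) x := fun x =>
    (db x).mul ((db (ξ - h * x)).comp x (dw x))
  have ca' : Continuous a' := by simp only [ha']; fun_prop
  have ba : ∀ x, |a x| ≤ 4 := fun x => by
    simp only [ha]; rw [abs_mul]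
    calc _ ≤ (2:ℝ) * 2 := mul_le_mul (bb _) (bb _) (abs_nonneg _) (by norm_num)
      _ = 4 := by norm_num
  have ba' : ∀ x, |a' x| ≤ 808 * n := fun x => by
    simp only [ha']
    refine (abs_add_le _ _).trans ?_
    rw [abs_mul, abs_mul, abs_mul, abs_neg, abs_of_pos hh]
    have k1 : |b' x| * |b (ξ - h * x)| ≤ 202 * n * 2 :=
      mul_le_mul (bb' _) (bb _) (abs_nonneg _) (by positivity)
    have k2 : |b x| * (|b' (ξ - h * x)| * h) ≤ 2 * (202 * n * 1) :=
      mul_le_mul (bb _) (mul_le_mul (bb' _) hh1 hh.le (by positivity)) (by positivity) (by norm_num)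
    linarith
  have hFa : F = fun x => Complex.exp (Complex.I * ((N * f x : ℝ) : ℂ)) * ((a x : ℝ) : ℂ) := rfl
  have cF : Continuous F := by
    have cf : Continuous f := continuous_iff_continuousAt.2 fun x => (df x).continuousAt
    have ca : Continuous a := continuous_iff_continuousAt.2 fun x => (da x).continuousAt
    rw [hFa]; fun_prop
  have nF : ∀ x, ‖F x‖ ≤ 4 := fun x => by
    rw [hFa]
    simp only []
    rw [norm_mul, mul_comm Complex.I, Complex.norm_exp_ofReal_mul_I, one_mul, Complex.norm_real]
    exact ba x
  have hξ0 : 0 < |ξ| := lt_of_lt_of_le (by positivity) hξ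
  have piece : ∀ p q, p ≤ q → α ≤ p → q ≤ β → (∀ x ∈ Icc p q, r ≤ |x - x₀|) →
      ‖∫ x in p..q, F x‖ ≤ 40000000 * r := by
    intro p q hpq hp hq hr'
    have sub : ∀ x ∈ Icc p q, 1 / l ≤ x ∧ x ≤ l ^ 2 ∧ |ξ - h * x| ≤ l ^ 2 := fun x hx =>
      (hJ x).1 ⟨hp.trans hx.1, hx.2.trans hq⟩
    have hd : q - p ≤ 2 := by
      have h1 := (sub p ⟨le_rfl, hpq⟩).1
      have h2 := (sub q ⟨hpq, le_rfl⟩).2.1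
      linarith
    refine le_trans (aux_ibp N x₀ r (n * |ξ| / 1024) 4 (808 * n) (4 * n ^ 2) p q f f' f'' a a'
      df df' cf'' da ca' hN0 hr (by positivity) (by norm_num) (by positivity) (by positivity) hpq
      ba ba' ?_ ?_ hr') (aux_const n ξ r N _ (q - p) hn hr hr1 hN rfl hξ hd)
    · intro x hx
      obtain ⟨h1, h2, h3⟩ := sub x hx
      have hx0 : 0 < x := lt_of_lt_of_le (by positivity) h1
      have p1 := pw x (by rwa [abs_of_pos hx0])
      have p2 := pw _ h3
      have p3 := Real.rpow_nonneg (abs_nonneg x) (n - 2)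
      have p4 := Real.rpow_nonneg (abs_nonneg (ξ - h * x)) (n - 2)
      have p5 : h ^ 2 * |ξ - h * x| ^ (n - 2) ≤ 1 * 4 :=
        mul_le_mul (by nlinarith) p2 p4 (by norm_num)
      have p6 : 0 ≤ h ^ 2 * |ξ - h * x| ^ (n - 2) := by positivity
      simp only [hf'']
      have hnn : 0 ≤ n * (n - 1) := mul_nonneg hn0.le (by linarith)
      rw [abs_mul, abs_of_nonneg hnn]
      have p7 : |(|x| ^ (n - 2) - h ^ 2 * |ξ - h * x| ^ (n - 2))| ≤ 4 :=
        abs_le.2 ⟨by linarith, by linarith⟩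
      calc _ ≤ n * (n - 1) * 4 := mul_le_mul_of_nonneg_left p7 hnn
        _ ≤ 4 * n ^ 2 := by nlinarith
    · intro x hx
      obtain ⟨h1, h2, h3⟩ := sub x hx
      exact hx₀ x (by linarith) (by linarith) (pl x h1) (pw _ h3) (by linarith)
  set p₁ := max α (min β (x₀ - r)) with hp₁
  set q₁ := max α (min β (x₀ + r)) with hq₁
  have o1 : α ≤ p₁ := le_max_left _ _
  have o2 : p₁ ≤ q₁ := max_le_max le_rfl (min_le_min le_rfl (by linarith))
  have o3 : q₁ ≤ β := max_le hαβ (min_le_left _ _)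
  have i1 : ‖∫ x in α..p₁, F x‖ ≤ 40000000 * r := by
    rcases o1.eq_or_lt with h0 | h0
    · rw [← h0, intervalIntegral.integral_same, norm_zero]; positivity
    · refine piece α p₁ o1 le_rfl (o2.trans o3) ?_
      intro x hx
      have : p₁ ≤ x₀ - r := by
        rcases lt_max_iff.1 h0 with h1 | h1
        · exact absurd h1 (lt_irrefl _)
        · rw [hp₁, max_eq_right h1.le]; exact min_le_right _ _
      rw [abs_sub_comm]
      exact le_trans (by linarith [hx.2]) (le_abs_self _)
  have i3 : ‖∫ x in q₁..β, F x‖ ≤ 40000000 * r := by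
    rcases o3.eq_or_lt with h0 | h0
    · rw [h0, intervalIntegral.integral_same, norm_zero]; positivity
    · refine piece q₁ β o3 (o1.trans o2) le_rfl ?_
      intro x hx
      have : x₀ + r ≤ q₁ := by
        have h1 : min β (x₀ + r) < β := lt_of_le_of_lt (le_max_right _ _) h0
        have h2 : min β (x₀ + r) = x₀ + r := by
          rcases min_choice β (x₀ + r) with h3 | h3
          · rw [h3] at h1; exact absurd h1 (lt_irrefl _)
          · exact h3
        rw [hq₁, h2]; exact le_max_right _ _
      exact le_trans (by linarith [hx.1]) (le_abs_self _)
  have i2 : ‖∫ x in p₁..q₁, F x‖ ≤ 8 * r := by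
    have h1 := intervalIntegral.norm_integral_le_of_norm_le_const (a := p₁) (b := q₁) (f := F) (C := 4)
      (fun x _ => nF x)
    refine h1.trans ?_
    rw [abs_of_nonneg (by linarith)]
    have : q₁ ≤ p₁ + 2 * r := by
      refine max_le (by linarith) ?_
      have : min β (x₀ + r) ≤ min β (x₀ - r) + 2 * r := by
        rw [← min_add_add_right]
        exact min_le_min (by linarith) (by linarith)
      have := le_max_right α (min β (x₀ - r))
      linarith
    linarith
  have ii : ∀ p q, IntervalIntegrable F volume p q := fun p q => cF.intervalIntegrable p q
  rw [← intervalIntegral.integral_add_adjacent_intervals (ii α p₁) (ii p₁ β),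
    ← intervalIntegral.integral_add_adjacent_intervals (ii p₁ q₁) (ii q₁ β)]
  refine (norm_add_le _ _).trans ?_
  have := norm_add_le (∫ x in p₁..q₁, F x) (∫ x in q₁..β, F x)
  linarith

lemma aux_full (n l h ξ r N : ℝ) (b b' : ℝ → ℝ) (hn : 2 ≤ n) (hl : 1 < l) (hl2 : l ^ 2 ≤ 2)
    (hln : l ^ n = 2) (hln1 : l ≤ 1 + 1 / n)
    (hh : 0 < h) (hh1 : h ≤ 1) (hr : 0 < r) (hr1 : r ≤ 1)
    (hN : N * r ^ 4 = 1)
    (db : ∀ t, HasDerivAt b (b' t) t) (cb' : Continuous b') (bb : ∀ t, |b t| ≤ 2)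
    (bb' : ∀ t, |b' t| ≤ 202 * n) (sb : ∀ t, b t ≠ 0 → 1 / l ≤ |t| ∧ |t| ≤ l ^ 2) :
    ‖∫ x, Complex.exp (Complex.I * ((N * (|x| ^ n - |ξ - h * x| ^ n) : ℝ) : ℂ)) *
      ((b x * b (ξ - h * x) : ℝ) : ℂ)‖ ≤ (200000000 / n) * Set.indicator
                    (Set.Icc (-(n * r)) (n * r)) (fun _ => (1 : ℝ)) ξ
                + 200000000 * r * Set.indicator (Set.Icc (-4 : ℝ) 4) (fun _ => (1 : ℝ)) ξ := by
  have hn0 : 0 < n := by linarith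
  have hl0 : 0 < l := by linarith
  set F : ℝ → ℂ := fun x => Complex.exp (Complex.I * ((N * (|x| ^ n - |ξ - h * x| ^ n) : ℝ) : ℂ)) *
      ((b x * b (ξ - h * x) : ℝ) : ℂ) with hF
  have F0 : ∀ x, b x * b (ξ - h * x) = 0 → F x = 0 := fun x hx => by
    simp only [hF]; rw [hx]; simp
  have nn1 : 0 ≤ Set.indicator (Set.Icc (-(n * r)) (n * r)) (fun _ => (1 : ℝ)) ξ :=
    indicator_nonneg (fun _ _ => zero_le_one) _
  have nn2 : 0 ≤ Set.indicator (Set.Icc (-4 : ℝ) 4) (fun _ => (1 : ℝ)) ξ :=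
    indicator_nonneg (fun _ _ => zero_le_one) _
  by_cases hξ4 : |ξ| ≤ 4
  swap
  · have : F = 0 := by
      funext x
      refine F0 x ?_
      by_contra hc
      have h1 := (sb x (left_ne_zero_of_mul hc)).2
      have h2 := (sb _ (right_ne_zero_of_mul hc)).2
      apply hξ4
      have e : ξ = (ξ - h * x) + h * x := by ring
      rw [e]
      refine (abs_add_le _ _).trans ?_
      rw [abs_mul, abs_of_pos hh]
      have : h * |x| ≤ 1 * 2 := mul_le_mul hh1 (by linarith) (abs_nonneg _) (by norm_num)
      linarith
    have e0 : ∫ x, F x = 0 := by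
      rw [this]; exact integral_zero ℝ ℂ
    rw [e0, norm_zero]
    positivity
  have ind2 : Set.indicator (Set.Icc (-4 : ℝ) 4) (fun _ => (1 : ℝ)) ξ = 1 :=
    indicator_of_mem (show ξ ∈ Icc (-4:ℝ) 4 from abs_le.1 hξ4) _
  have nF : ∀ x, ‖F x‖ ≤ 4 := fun x => by
    simp only [hF]
    rw [norm_mul, mul_comm Complex.I, Complex.norm_exp_ofReal_mul_I, one_mul, Complex.norm_real,
      Real.norm_eq_abs, abs_mul]
    calc _ ≤ (2:ℝ) * 2 := mul_le_mul (bb _) (bb _) (abs_nonneg _) (by norm_num)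
      _ = 4 := by norm_num
  set S : Set ℝ := Icc (1 / l) (l ^ 2) ∪ Icc (-(l ^ 2)) (-(1 / l)) with hS
  have FS : ∀ x, x ∉ S → F x = 0 := fun x hx => by
    refine F0 x ?_
    by_contra hc
    obtain ⟨h1, h2⟩ := sb x (left_ne_zero_of_mul hc)
    apply hx
    rcases le_total 0 x with h0 | h0
    · rw [abs_of_nonneg h0] at h1 h2
      exact Or.inl ⟨h1, h2⟩
    · rw [abs_of_nonpos h0] at h1 h2
      exact Or.inr ⟨by linarith, by linarith⟩
  by_cases hξ : |ξ| ≤ n * r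
  · have ind1 : Set.indicator (Set.Icc (-(n * r)) (n * r)) (fun _ => (1 : ℝ)) ξ = 1 :=
      indicator_of_mem (show ξ ∈ Icc (-(n * r)) (n * r) from abs_le.1 hξ) _
    rw [ind1, ind2, ← setIntegral_eq_integral_of_forall_compl_eq_zero FS]
    have hSfin : volume S < ⊤ := by
      refine (measure_union_le _ _).trans_lt ?_
      simp
    have h1 := norm_setIntegral_le_of_norm_le_const (f := F) (C := 4) hSfin (fun x _ => nF x)
    have len : l ^ 2 - 1 / l ≤ 4 / n := by
      have k1 : 1 - 1 / n ≤ 1 / l := by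
        rw [le_div_iff₀ hl0]
        have : 0 < 1 / n := by positivity
        have : 1 / n ≤ 1 / 2 := one_div_le_one_div_of_le (by norm_num) hn
        nlinarith
      have k2 : 4 / n = 4 * (1 / n) := by ring
      have k3 : 0 < 1 / n := by positivity
      have k4 : 1 / n ≤ 1 / 2 := one_div_le_one_div_of_le (by norm_num) hn
      rw [k2]
      nlinarith
    have vol : volume.real S ≤ 8 / n := by
      have hle : 1 / l ≤ l ^ 2 := by
        have : 1 / l ≤ 1 := by rw [div_le_one hl0]; linarith
        nlinarith
      refine (measureReal_union_le _ _).trans ?_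
      rw [Real.volume_real_Icc_of_le hle, Real.volume_real_Icc_of_le (by linarith)]
      have : 8 / n = 4 / n + 4 / n := by ring
      linarith
    have e8 : 4 * (8 / n) = 32 / n := by ring
    have e9 : 32 / n ≤ 200000000 / n := by gcongr; norm_num
    nlinarith
  · push Not at hξ
    rw [ind2]
    have cb : Continuous b := continuous_iff_continuousAt.2 fun x => (db x).continuousAt
    have cF : Continuous F := by
      have h1 : Continuous (fun t : ℝ => |t| ^ n) :=
        continuous_abs.rpow_const (fun _ => Or.inr (by linarith))
      have h2 : Continuous (fun t : ℝ => |ξ - h * t| ^ n) := h1.comp (by fun_prop)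
      simp only [hF]
      fun_prop
    have iF : Integrable F := by
      refine cF.integrable_of_hasCompactSupport
        (HasCompactSupport.intro ((isCompact_Icc).union isCompact_Icc) (fun x hx => FS x hx))
    rw [← intervalIntegral.integral_Iic_add_Ioi (b := (0:ℝ)) iF.integrableOn iF.integrableOn]
    have p1 := aux_half n l h ξ r N b b' hn hl hl2 hln hh hh1 hξ4 hr hr1 hN hξ.le db cb' bb bb' sb
    have p2 := aux_half n l h (-ξ) r N (fun t => b (-t)) (fun t => -b' (-t)) hn hl hl2 hln hh hh1
      (by rwa [abs_neg]) hr hr1 hN (by rw [abs_neg]; exact hξ.le)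
      (fun t => by
        have := (db (-t)).comp t (hasDerivAt_neg t)
        exact this.congr_deriv (by ring)) (by fun_prop) (fun t => bb _)
      (fun t => by rw [abs_neg]; exact bb' _) (fun t ht => by
        have := sb (-t) ht
        rwa [abs_neg] at this)
    have e : ∫ x in Iic (0:ℝ), F x = ∫ x in Ioi (0:ℝ),
        Complex.exp (Complex.I * ((N * (|x| ^ n - |-ξ - h * x| ^ n) : ℝ) : ℂ)) *
      ((b (-x) * b (-(-ξ - h * x)) : ℝ) : ℂ) := by
      have := integral_comp_neg_Ioi (0:ℝ) F
      rw [neg_zero] at this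
      rw [← this]
      congr 1
      funext x
      simp only [hF]
      have e1 : ξ - h * -x = -(-ξ - h * x) := by ring
      rw [e1, abs_neg, abs_neg]
    rw [← e] at p2
    refine (norm_add_le _ _).trans ?_
    have : 0 ≤ 200000000 / n * Set.indicator (Set.Icc (-(n * r)) (n * r)) (fun _ => (1 : ℝ)) ξ := by
      positivity
    linarith

theorem stmt_14 :
    ∃ C : ℝ, 0 < C ∧
      ∀ n : ℝ, 2 ≤ n → ∀ l : ℝ, l = (2 : ℝ) ^ (1 / n) →
        ∀ ψ₀ : ℝ → ℝ, ContDiff ℝ 1 ψ₀ → (∀ t, ψ₀ t ∈ Set.Icc (0 : ℝ) 1) →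
          (∀ t, ψ₀ t ≠ 0 → t ∈ Set.Ioo (1 / l) (l ^ 2) ∪ Set.Ioo (-(l ^ 2)) (-(1 / l))) →
          (∀ t ∈ Set.Icc (1 : ℝ) l ∪ Set.Icc (-l) (-1 : ℝ), ψ₀ t = 1) →
          (∀ t : ℝ, |deriv ψ₀ t| ≤ 100 * n) →
          ∀ j : ℕ, ∀ h : ℝ, h ∈ Set.Ioc (0 : ℝ) 1 → ∀ ξ : ℝ,
            ‖∫ η : ℝ,
                Complex.exp (Complex.I *
                  (((2 : ℝ) ^ j * (|η| ^ n - |ξ - h * η| ^ n) : ℝ) : ℂ)) *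
                  ((ψ₀ η / η : ℝ) : ℂ) * ((ψ₀ (ξ - h * η) / (ξ - h * η) : ℝ) : ℂ)‖
              ≤ (C / n) * Set.indicator
                    (Set.Icc (-(n * (2 : ℝ) ^ (-(j : ℝ) / 4))) (n * (2 : ℝ) ^ (-(j : ℝ) / 4)))
                    (fun _ => (1 : ℝ)) ξ
                + C * (2 : ℝ) ^ (-(j : ℝ) / 4) *
                    Set.indicator (Set.Icc (-4 : ℝ) 4) (fun _ => (1 : ℝ)) ξ := by
  refine ⟨200000000, by norm_num, ?_⟩
  intro n hn l hl ψ hψ h01 hsupp _ hder j h hh ξ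
  have hn0 : 0 < n := by linarith
  have hln : l ^ n = 2 := by
    rw [hl, ← Real.rpow_mul (by norm_num), one_div, inv_mul_cancel₀ hn0.ne', Real.rpow_one]
  have hl1 : 1 < l := by
    rw [hl]; exact Real.one_lt_rpow (by norm_num) (by positivity)
  have hl0 : 0 < l := by linarith
  have hl2 : l ^ 2 ≤ 2 := by
    rw [← hln, ← Real.rpow_natCast]
    exact Real.rpow_le_rpow_of_exponent_le hl1.le (by exact_mod_cast hn)
  have hln1 : l ≤ 1 + 1 / n := by
    have h1 : 1 + n * (1 / n) ≤ (1 + 1 / n) ^ n :=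
      one_add_mul_self_le_rpow_one_add (by have : 0 < 1 / n := by positivity
                                           linarith) (by linarith)
    have h2 : n * (1 / n) = 1 := by field_simp
    by_contra hc
    push Not at hc
    have h3 := Real.rpow_lt_rpow (by positivity) hc hn0
    rw [hln] at h3
    linarith
  have hll : 1 / 2 ≤ 1 / l := one_div_le_one_div_of_le hl0 (by nlinarith)
  have hsupp' : ∀ t, ψ t ≠ 0 → 1 / l < |t| ∧ |t| < l ^ 2 := by
    intro t ht
    rcases hsupp t ht with h1 | h1
    · have : 0 < t := lt_trans (by positivity) h1.1
      rw [abs_of_pos this]; exact h1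
    · have h2 : 0 < 1 / l := by positivity
      have : t < 0 := by linarith [h1.2]
      rw [abs_of_neg this]
      exact ⟨by linarith [h1.2], by linarith [h1.1]⟩
  set b : ℝ → ℝ := fun t => ψ t / t with hb
  have bz : ∀ t, |t| < 1 / 2 → b =ᶠ[𝓝 t] fun _ => 0 := by
    intro t ht
    have : {s : ℝ | |s| < 1 / 2} ∈ 𝓝 t := (isOpen_lt continuous_abs continuous_const).mem_nhds ht
    filter_upwards [this] with s hs
    have : ψ s = 0 := by
      by_contra hc
      have := (hsupp' s hc).1
      have hs : |s| < 1 / 2 := hs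
      linarith
    simp [hb, this]
  have cdb : ContDiff ℝ 1 b := by
    rw [contDiff_iff_contDiffAt]
    intro t
    by_cases ht : |t| < 1 / 2
    · exact contDiffAt_const.congr_of_eventuallyEq (bz t ht)
    · have : t ≠ 0 := by rintro rfl; apply ht; norm_num
      exact hψ.contDiffAt.div contDiffAt_id this
  have dψ : Differentiable ℝ ψ := hψ.differentiable (by norm_num)
  have key := aux_full n l h ξ ((2:ℝ) ^ (-(j:ℝ) / 4)) (2 ^ j) b (deriv b) hn hl1 hl2 hln hln1
    hh.1 hh.2 (by positivity) (Real.rpow_le_one_of_one_le_of_nonpos (by norm_num) (by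
      have : (0:ℝ) ≤ j := Nat.cast_nonneg j
      linarith)) (by
      rw [← Real.rpow_natCast, ← Real.rpow_natCast, ← Real.rpow_mul (by norm_num),
        ← Real.rpow_add (by norm_num)]
      have : (j:ℝ) + -(j:ℝ) / 4 * ((4:ℕ):ℝ) = 0 := by push_cast; ring
      rw [this, Real.rpow_zero])
    (fun t => ((cdb.differentiable (by norm_num)) t).hasDerivAt)
    (cdb.continuous_deriv le_rfl)
    (by
      intro t
      by_cases ht : ψ t = 0
      · simp [hb, ht]
      · have h1 := (hsupp' t ht).1
        simp only [hb]
        rw [abs_div, div_le_iff₀ (by linarith), abs_of_nonneg (h01 t).1]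
        linarith [(h01 t).2])
    (by
      intro t
      by_cases ht : |t| < 1 / 2
      · rw [(bz t ht).deriv_eq]; simp; positivity
      · have ht0 : t ≠ 0 := by rintro rfl; apply ht; norm_num
        push Not at ht
        have hd : deriv b t = deriv ψ t / t - ψ t / t ^ 2 := by
          have := ((dψ t).hasDerivAt.div (hasDerivAt_id t) ht0).deriv
          have e : deriv b t = (deriv ψ t * id t - ψ t * 1) / id t ^ 2 := this
          rw [e]; simp only [id]; field_simp
        rw [hd]
        refine (abs_sub _ _).trans ?_
        rw [abs_div, abs_div, abs_pow, abs_of_nonneg (h01 t).1]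
        have k1 : |deriv ψ t| / |t| ≤ 100 * n / (1 / 2) :=
          div_le_div₀ (by positivity) (hder t) (by norm_num) ht
        have k2 : ψ t / |t| ^ 2 ≤ 1 / (1 / 2) ^ 2 :=
          div_le_div₀ (by positivity) (h01 t).2 (by norm_num) (pow_le_pow_left₀ (by norm_num) ht 2)
        have k3 : (1:ℝ) / (1 / 2) ^ 2 = 4 := by norm_num
        have k4 : 100 * n / (1 / 2) = 200 * n := by ring
        rw [k3] at k2
        rw [k4] at k1
        linarith)
    (by
      intro t ht
      have : ψ t ≠ 0 := by
        intro h0; apply ht; simp [hb, h0]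
      exact ⟨(hsupp' t this).1.le, (hsupp' t this).2.le⟩)
  refine le_trans (le_of_eq ?_) key
  congr 2
  funext x
  rw [mul_assoc, ← Complex.ofReal_mul]
end
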